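/- arXiv:1911.11724 — 6 statements merged into one kernel-verified Lean document; each statement's English description precedes it below -/
import Mathlib

section
/- Let Λ be a positive definite even unimodular lattice that is generated (over ℤ) by its roots. Fix τ in the upper half-plane ℍ. Suppose f : Λ⊗ℂ → ℂ is holomorphic and satisfies, for every root α of Λ, every m ∈ Λ⊗ℂ and all ε₁, ε₂ ∈ ℂ, the functional equation θ₁(τ, ε₂)·θ₁(τ, α·m + ε₂)·f(m + ε₁α) − θ₁(τ, ε₁)·θ₁(τ, α·m + ε₁)·f(m + ε₂α) = θ₁(τ, ε₂ − ε₁)·θ₁(τ, α·m + ε₁ + ε₂)·f(m). Then there exists a constant c ∈ ℂ such that f(m) = c·θ_Λ(τ, m) for all m ∈ Λ⊗ℂ. -/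
/-- The Jacobi theta function θ₁(τ,z). -/
noncomputable def theta1 (τ z : ℂ) : ℂ :=
  -Complex.I * ∑' n : ℤ, (-1 : ℂ) ^ n *
    Complex.exp (Real.pi * Complex.I * τ * ((n : ℂ) + 1 / 2) ^ 2 +
      2 * Real.pi * Complex.I * ((n : ℂ) + 1 / 2) * z)

/-- The standard dot product on ℝ^N. -/
def dotR {N : ℕ} (x y : Fin N → ℝ) : ℝ := ∑ i, x i * y i

/-- The bilinear extension of the dot product to the complexification ℂ^N. -/
noncomputable def dotC {N : ℕ} (m : Fin N → ℂ) (w : Fin N → ℝ) : ℂ := ∑ i, m i * (w i : ℂ)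

/-- The theta function of a lattice Λ ⊆ ℝ^N. -/
noncomputable def thetaLat {N : ℕ} (Λ : Submodule ℤ (Fin N → ℝ)) (τ : ℂ) (m : Fin N → ℂ) : ℂ :=
  ∑' w : Λ, Complex.exp (2 * Real.pi * Complex.I *
    (τ * (dotR (w : Fin N → ℝ) (w : Fin N → ℝ) : ℂ) / 2 + dotC m (w : Fin N → ℝ)))


open MeasureTheory

section JacobiTheta

open Complex Real

lemma theta1_eq_jacobiTheta₂ (τ z : ℂ) :
    theta1 τ z = -I * cexp (π * I * τ / 4 + π * I * z) * jacobiTheta₂ (z + τ / 2 + 1 / 2) τ := by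
  rw [theta1, jacobiTheta₂, mul_assoc (-I)]
  congr 1
  rw [← tsum_mul_left]
  refine tsum_congr fun n => ?_
  have h : (-1 : ℂ) ^ n = cexp (n * (π * I)) := by
    rw [Complex.exp_int_mul, Complex.exp_pi_mul_I]
  rw [h, jacobiTheta₂_term, ← Complex.exp_add, ← Complex.exp_add]
  congr 1
  ring

lemma theta1_add_one (τ z : ℂ) : theta1 τ (z + 1) = -theta1 τ z := by
  have h₁ : z + 1 + τ / 2 + 1 / 2 = (z + τ / 2 + 1 / 2) + 1 := by ring
  have h₂ : π * I * τ / 4 + π * I * (z + 1) = (π * I * τ / 4 + π * I * z) + π * I := by ring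
  rw [theta1_eq_jacobiTheta₂, theta1_eq_jacobiTheta₂, h₁, jacobiTheta₂_add_left, h₂,
    Complex.exp_add _ (π * I), Complex.exp_pi_mul_I]
  ring

lemma theta1_add_tau (τ z : ℂ) :
    theta1 τ (z + τ) = -cexp (-(π * I * τ) - 2 * π * I * z) * theta1 τ z := by
  have h₁ : z + τ + τ / 2 + 1 / 2 = (z + τ / 2 + 1 / 2) + τ := by ring
  have h₂ : cexp (π * I * τ / 4 + π * I * (z + τ)) *
      cexp (-π * I * (τ + 2 * (z + τ / 2 + 1 / 2))) =
      -(cexp (-(π * I * τ) - 2 * π * I * z) * cexp (π * I * τ / 4 + π * I * z)) := by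
    have h : (-1 : ℂ) = cexp (-(π * I)) := by rw [Complex.exp_neg, Complex.exp_pi_mul_I]; norm_num
    rw [← mul_neg_one (_ * _), h, ← Complex.exp_add, ← Complex.exp_add, ← Complex.exp_add]
    congr 1
    ring
  rw [theta1_eq_jacobiTheta₂, theta1_eq_jacobiTheta₂, h₁, jacobiTheta₂_add_left']
  linear_combination (-I * jacobiTheta₂ (z + τ / 2 + 1 / 2) τ) * h₂

lemma theta1_zero (τ : ℂ) : theta1 τ 0 = 0 := by
  have h₁ : (0 : ℂ) + τ / 2 + 1 / 2 = ((-(τ / 2 + 1 / 2) : ℂ) + τ) + 1 := by ring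
  have h₂ : cexp (-π * I * (τ + 2 * -(τ / 2 + 1 / 2))) = -1 := by
    rw [← Complex.exp_pi_mul_I]
    congr 1
    ring
  have h₃ := jacobiTheta₂_add_left' (-(τ / 2 + 1 / 2)) τ
  rw [← jacobiTheta₂_add_left, ← h₁, jacobiTheta₂_neg_left, h₂, zero_add] at h₃
  rw [theta1_eq_jacobiTheta₂, zero_add, self_eq_neg.mp (h₃.trans (neg_one_mul _)), mul_zero]

lemma differentiable_theta1 {τ : ℂ} (hτ : 0 < τ.im) : Differentiable ℂ (theta1 τ) := by
  have h : theta1 τ = fun z => -I * cexp (π * I * τ / 4 + π * I * z) *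
      jacobiTheta₂ (z + τ / 2 + 1 / 2) τ := funext (theta1_eq_jacobiTheta₂ τ)
  rw [h]
  intro z
  have hJ := (differentiableAt_jacobiTheta₂_fst (z + τ / 2 + 1 / 2) hτ).comp z
    (f := fun z : ℂ => z + τ / 2 + 1 / 2) (by fun_prop)
  exact DifferentiableAt.mul (by fun_prop) hJ

lemma exists_jacobiTheta₂_ne_zero {τ : ℂ} (hτ : 0 < τ.im) : ∃ z, jacobiTheta₂ z τ ≠ 0 := by
  by_contra! h
  let g : ℤ → C(ℝ, ℂ) := fun n =>
    ⟨fun x => jacobiTheta₂_term n x τ, by unfold jacobiTheta₂_term; fun_prop⟩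
  have hsum := intervalIntegral.hasSum_intervalIntegral_of_summable_norm (f := g) (a := 0) (b := 1) <| by
    refine ((summable_jacobiTheta₂_term_iff 0 τ).mpr hτ).norm.of_nonneg_of_le
      (fun _ => norm_nonneg _) fun n => ?_
    refine (ContinuousMap.norm_le _ (norm_nonneg _)).mpr fun x => ?_
    simp [g, norm_jacobiTheta₂_term]
  have hzero : ∀ n : ℤ, n ≠ 0 → ∫ x in (0 : ℝ)..1, g n x = 0 := by
    intro n hn
    have hc : 2 * π * I * n ≠ 0 := by
      simp [hn, Real.pi_ne_zero]
    have he : ∀ x : ℝ, g n x = cexp (2 * π * I * n * x) * cexp (π * I * n ^ 2 * τ) := by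
      intro x
      simp [g, jacobiTheta₂_term, Complex.exp_add]
    simp_rw [he, intervalIntegral.integral_mul_const, integral_exp_mul_complex hc]
    have : cexp (2 * π * I * n) = 1 := by
      rw [mul_comm, Complex.exp_int_mul_two_pi_mul_I]
    simp [this]
  have h₀ : ∑' n : ℤ, ∫ x in (0 : ℝ)..1, g n x = 1 := by
    rw [tsum_eq_single 0 hzero]
    simp [g, jacobiTheta₂_term]
  have hz : ∀ x : ℝ, ∑' n : ℤ, g n x = 0 := fun x => h x
  rw [hsum.tsum_eq] at h₀
  simp [hz] at h₀

lemma exists_theta1_mul_ne_zero {τ : ℂ} (hτ : 0 < τ.im) (a : ℂ) :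
    ∃ ε, theta1 τ ε * theta1 τ (a + ε) ≠ 0 := by
  by_contra! h
  obtain ⟨z, hz⟩ := exists_jacobiTheta₂_ne_zero hτ
  have hz' : theta1 τ (z - τ / 2 - 1 / 2) ≠ 0 := by
    rw [theta1_eq_jacobiTheta₂, show z - τ / 2 - 1 / 2 + τ / 2 + 1 / 2 = z by ring]
    simp [hz]
  have hd := differentiable_theta1 hτ
  have hd' : Differentiable ℂ fun ε => theta1 τ (a + ε) := hd.comp (by fun_prop)
  rcases AnalyticOnNhd.eq_zero_or_eq_zero_of_mul_eq_zero (hd.differentiableOn.analyticOnNhd isOpen_univ)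
    (hd'.differentiableOn.analyticOnNhd isOpen_univ) (fun ε _ => h ε) isPreconnected_univ with h' | h'
  · exact hz' (h' _ trivial)
  · exact hz' (by simpa using h' (z - τ / 2 - 1 / 2 - a) trivial)

end JacobiTheta

section ParametricIntegral

/-- The integral over a compact space of a function holomorphic in a parameter is holomorphic. -/
lemma differentiable_integral_of_continuous {X : Type*} [TopologicalSpace X] [CompactSpace X]
    [SecondCountableTopology X] [MeasurableSpace X] [BorelSpace X] {μ : Measure X}
    [IsFiniteMeasure μ] {Φ : X → ℂ → ℂ} (hc : Continuous Φ.uncurry)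
    (hd : ∀ x, Differentiable ℂ (Φ x)) : Differentiable ℂ fun t => ∫ x, Φ x t ∂μ := by
  intro t₀
  obtain ⟨M, hM⟩ := ((isCompact_univ (X := X)).prod
    (isCompact_closedBall t₀ 2)).exists_bound_of_continuousOn hc.continuousOn
  have hs : ∀ t, Continuous fun x => Φ x t := fun t => hc.comp (Continuous.prodMk_left t)
  refine (hasDerivAt_integral_of_dominated_loc_of_deriv_le (F := fun t x => Φ x t)
    (F' := fun t x => deriv (Φ x) t) (bound := fun _ => M)
    (Metric.ball_mem_nhds t₀ one_pos) (.of_forall fun t => (hs t).aestronglyMeasurable)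
    ((hs t₀).integrable_of_hasCompactSupport (.of_compactSpace _))
    ((stronglyMeasurable_deriv_with_param hc).comp_measurable
      measurable_prodMk_right).aestronglyMeasurable
    (.of_forall fun x t ht => ?_) (integrable_const M)
    (.of_forall fun x t _ => (hd x t).hasDerivAt)).2.differentiableAt
  have := Complex.norm_deriv_le_of_forall_mem_sphere_norm_le one_pos (hd x).diffContOnCl
    (c := t) (C := M) fun z hz => hM (x, z) ⟨trivial, ?_⟩
  · simpa using this
  · rw [Metric.mem_closedBall]
    rw [Metric.mem_sphere] at hz
    rw [Metric.mem_ball] at ht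
    linarith [dist_triangle z t t₀]

end ParametricIntegral

section Torus

variable {ι : Type*}

/-- The projection from `ℝ^ι` to the torus. -/
def torusMk (x : ι → ℝ) : UnitAddTorus ι := fun i => (x i : UnitAddCircle)

lemma isOpenQuotientMap_torusMk : IsOpenQuotientMap (torusMk (ι := ι)) :=
  IsOpenQuotientMap.piMap fun _ => QuotientAddGroup.isOpenQuotientMap_mk

/-- The function on the torus which agrees with `g` on `[0, 1)^ι`. -/
noncomputable def torusLift (g : (ι → ℝ) → ℂ) (y : UnitAddTorus ι) : ℂ :=
  g fun i => AddCircle.equivIco 1 0 (y i)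

lemma torusLift_torusMk {g : (ι → ℝ) → ℂ}
    (hg : ∀ (x : ι → ℝ) (k : ι → ℤ), g (x + fun i => (k i : ℝ)) = g x) (x : ι → ℝ) :
    torusLift g (torusMk x) = g x := by
  rw [torusLift, ← hg _ fun i => ⌊x i⌋]
  congr 1
  funext i
  simp only [torusMk, Pi.add_apply]
  have := AddCircle.coe_equivIco_mk_apply (1 : ℝ) (x i)
  rw [div_one, mul_one] at this
  exact (congrArg (· + (⌊x i⌋ : ℝ)) this).trans (Int.fract_add_floor _)

lemma torusLift_shift_torusMk {F : (ι → ℂ) → ℂ}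
    (hper : ∀ (z : ι → ℂ) (k : ι → ℤ), F (z + fun i => (k i : ℂ)) = F z) (z : ι → ℂ) (x : ι → ℝ) :
    torusLift (fun x => F fun i => x i + z i) (torusMk x) = F fun i => x i + z i := by
  refine torusLift_torusMk (fun x k => ?_) x
  rw [← hper (fun i => x i + z i) k]
  congr 1
  funext i
  simp only [Pi.add_apply]
  push_cast
  ring

lemma continuous_torusLift_shift {F : (ι → ℂ) → ℂ} {T : Type*} [TopologicalSpace T] {g : T → ι → ℂ}
    (hg : Continuous g) (hF : Continuous F)
    (hper : ∀ (z : ι → ℂ) (k : ι → ℤ), F (z + fun i => (k i : ℂ)) = F z) :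
    Continuous fun p : UnitAddTorus ι × T => torusLift (fun x => F fun i => x i + g p.2 i) p.1 := by
  have hq := (isOpenQuotientMap_torusMk (ι := ι)).prodMap (IsOpenQuotientMap.id (X := T))
  rw [hq.isQuotientMap.continuous_iff]
  have : (fun p : UnitAddTorus ι × T => torusLift (fun x => F fun i => x i + g p.2 i) p.1) ∘
      Prod.map torusMk id = fun p : (ι → ℝ) × T => F fun i => p.1 i + g p.2 i := by
    funext p
    exact torusLift_shift_torusMk hper (g p.2) p.1
  rw [this]
  fun_prop

variable [Fintype ι]

lemma mFourier_torusMk (n : ι → ℤ) (x : ι → ℝ) :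
    UnitAddTorus.mFourier n (torusMk x) =
      Complex.exp (2 * Real.pi * Complex.I * ∑ i, (n i : ℂ) * (x i : ℂ)) := by
  simp only [UnitAddTorus.mFourier, torusMk, ContinuousMap.coe_mk, fourier_coe_apply]
  rw [← Complex.exp_sum, Finset.mul_sum]
  congr 1
  refine Finset.sum_congr rfl fun i _ => ?_
  push_cast
  ring

/-- The normalized Haar measure on the torus. -/
noncomputable abbrev torusMeasure (ι : Type*) [Fintype ι] : Measure (UnitAddTorus ι) :=
  Measure.pi fun _ => (AddCircle.haarAddCircle : Measure UnitAddCircle)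

/-- The Fourier coefficient of the restriction to `ℝ^ι` of a `ℤ^ι`-periodic function. -/
noncomputable def periodicCoeff (F : (ι → ℂ) → ℂ) (n : ι → ℤ) : ℂ :=
  ∫ y, torusLift (fun x => Complex.exp (-(2 * Real.pi * Complex.I * ∑ i, (n i : ℂ) * (x i : ℂ))) *
    F fun i => (x i : ℂ)) y ∂torusMeasure ι

variable {F : (ι → ℂ) → ℂ}

/-- The mean over a real period of a holomorphic periodic function does not depend on the
imaginary part of the contour. -/
lemma integral_torusLift_shift (hF : Differentiable ℂ F)
    (hper : ∀ (z : ι → ℂ) (k : ι → ℤ), F (z + fun i => (k i : ℂ)) = F z) (z : ι → ℂ) :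
    ∫ y, torusLift (fun x => F fun i => x i + z i) y ∂torusMeasure ι =
      ∫ y, torusLift (fun x => F fun i => x i) y ∂torusMeasure ι := by
  let g : ℂ → ι → ℂ := fun t i => (z i).re + t * (z i).im
  have hg : Differentiable ℂ g := by fun_prop
  let J : ℂ → ℂ := fun t => ∫ y, torusLift (fun x => F fun i => x i + g t i) y ∂torusMeasure ι
  have hJ : Differentiable ℂ J := by
    refine differentiable_integral_of_continuous
      (Φ := fun y t => torusLift (fun x => F fun i => x i + g t i) y)
      (continuous_torusLift_shift hg.continuous hF.continuous hper) fun y => ?_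
    exact hF.comp (by fun_prop)
  have hreal : ∀ t : ℝ, J t = ∫ y, torusLift (fun x => F fun i => x i) y ∂torusMeasure ι := by
    intro t
    rw [← integral_add_right_eq_self _ (torusMk fun i => (z i).re + t * (z i).im)]
    refine integral_congr_ae (.of_forall fun y => ?_)
    obtain ⟨x, rfl⟩ := isOpenQuotientMap_torusMk.surjective y
    have h := torusLift_shift_torusMk hper 0
    simp only [Pi.zero_apply, add_zero] at h
    have hadd : torusMk x + torusMk (fun i => (z i).re + t * (z i).im) =
      torusMk (x + fun i => (z i).re + t * (z i).im) := rfl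
    simp only [torusLift_shift_torusMk hper, hadd, h]
    congr 1
    funext i
    simp [g]
  have hconst : J = fun _ => ∫ y, torusLift (fun x => F fun i => x i) y ∂torusMeasure ι := by
    refine AnalyticOnNhd.eq_of_frequently_eq (z₀ := 0)
      (hJ.differentiableOn.analyticOnNhd isOpen_univ) analyticOnNhd_const ?_
    have hlim : Filter.Tendsto (fun t : ℝ => (t : ℂ)) (nhdsWithin 0 {0}ᶜ) (nhdsWithin 0 {0}ᶜ) :=
      tendsto_nhdsWithin_of_tendsto_nhds_of_eventually_within _
        (Complex.continuous_ofReal.tendsto' 0 0 rfl |>.mono_left nhdsWithin_le_nhds)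
        (eventually_nhdsWithin_of_forall fun t ht => by simpa using ht)
    exact hlim.frequently (Filter.Eventually.of_forall hreal).frequently
  have := congrFun hconst Complex.I
  simp only [J, g] at this
  rw [← this]
  simp only [mul_comm Complex.I, Complex.re_add_im]

lemma differentiable_exp_mul (hF : Differentiable ℂ F) (n : ι → ℤ) :
    Differentiable ℂ fun z : ι → ℂ =>
      Complex.exp (-(2 * Real.pi * Complex.I * ∑ i, (n i : ℂ) * z i)) * F z := by
  fun_prop

lemma exp_mul_periodic
    (hper : ∀ (z : ι → ℂ) (k : ι → ℤ), F (z + fun i => (k i : ℂ)) = F z) (n : ι → ℤ)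
    (z : ι → ℂ) (k : ι → ℤ) :
    Complex.exp (-(2 * Real.pi * Complex.I * ∑ i, (n i : ℂ) * (z + fun i => (k i : ℂ)) i)) *
      F (z + fun i => (k i : ℂ)) =
    Complex.exp (-(2 * Real.pi * Complex.I * ∑ i, (n i : ℂ) * z i)) * F z := by
  rw [hper]
  congr 1
  rw [Complex.exp_eq_exp_iff_exists_int]
  refine ⟨-∑ i, n i * k i, ?_⟩
  simp only [Pi.add_apply, mul_add, Finset.sum_add_distrib]
  push_cast
  ring

/-- Fourier coefficients along a shifted contour. -/
lemma mFourierCoeff_torusLift_shift (hF : Differentiable ℂ F)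
    (hper : ∀ (z : ι → ℂ) (k : ι → ℤ), F (z + fun i => (k i : ℂ)) = F z) (z : ι → ℂ)
    (n : ι → ℤ) :
    UnitAddTorus.mFourierCoeff (torusLift fun x => F fun i => x i + z i) n =
      periodicCoeff F n * Complex.exp (2 * Real.pi * Complex.I * ∑ i, (n i : ℂ) * z i) := by
  have h := integral_torusLift_shift (differentiable_exp_mul hF n) (exp_mul_periodic hper n) z
  have hlift := torusLift_shift_torusMk (F := fun z : ι → ℂ =>
    Complex.exp (-(2 * Real.pi * Complex.I * ∑ i, (n i : ℂ) * z i)) * F z)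
    (exp_mul_periodic hper n) z
  rw [periodicCoeff, ← h, ← integral_mul_const]
  refine integral_congr_ae (.of_forall fun y => ?_)
  obtain ⟨x, rfl⟩ := isOpenQuotientMap_torusMk.surjective y
  simp only [smul_eq_mul]
  rw [torusLift_shift_torusMk hper, mFourier_torusMk,
    hlift x, mul_right_comm (Complex.exp _), ← Complex.exp_add]
  congr 2
  simp only [Pi.neg_apply, Int.cast_neg, neg_mul, Finset.sum_neg_distrib, mul_add,
    Finset.sum_add_distrib]
  ring

/-- Fourier expansion of a periodic holomorphic function. -/
lemma hasSum_periodicCoeff (hF : Differentiable ℂ F)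
    (hper : ∀ (z : ι → ℂ) (k : ι → ℤ), F (z + fun i => (k i : ℂ)) = F z) (z : ι → ℂ)
    (hs : Summable fun n => periodicCoeff F n *
      Complex.exp (2 * Real.pi * Complex.I * ∑ i, (n i : ℂ) * z i)) :
    HasSum (fun n => periodicCoeff F n *
      Complex.exp (2 * Real.pi * Complex.I * ∑ i, (n i : ℂ) * z i)) (F z) := by
  have hc : Continuous (torusLift fun x => F fun i => x i + z i) :=
    (continuous_torusLift_shift (T := Unit) (g := fun _ => z) continuous_const hF.continuous
      hper).comp (Continuous.prodMk_left ())
  have hcoeff := funext (mFourierCoeff_torusLift_shift hF hper z)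
  have h := UnitAddTorus.hasSum_mFourier_series_apply_of_summable (f := ⟨_, hc⟩)
    (by rw [ContinuousMap.coe_mk, hcoeff]; exact hs) (torusMk 0)
  simpa [hcoeff, mFourier_torusMk, torusLift_shift_torusMk hper] using h

/-- The effect of quasi-periodicity on Fourier coefficients. -/
lemma periodicCoeff_of_quasiperiodic (hF : Differentiable ℂ F)
    (hper : ∀ (z : ι → ℂ) (k : ι → ℤ), F (z + fun i => (k i : ℂ)) = F z) {w : ι → ℂ}
    {n : ι → ℤ} {A : ℂ} (hw : ∀ z, F (z + w) =
      A * (Complex.exp (-(2 * Real.pi * Complex.I * ∑ i, (n i : ℂ) * z i)) * F z)) :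
    periodicCoeff F 0 = A * periodicCoeff F n := by
  have h := integral_torusLift_shift hF hper w
  rw [periodicCoeff, periodicCoeff, ← integral_const_mul]
  simp only [Pi.zero_apply, Int.cast_zero, zero_mul, Finset.sum_const_zero, mul_zero, neg_zero,
    Complex.exp_zero, one_mul]
  rw [← h]
  exact integral_congr_ae (.of_forall fun y => hw _)

end Torus

section Lattice

open Complex

variable {N : ℕ}

lemma dotR_comm (x y : Fin N → ℝ) : dotR x y = dotR y x :=
  Finset.sum_congr rfl fun _ _ => mul_comm _ _

lemma dotR_add_left (x y w : Fin N → ℝ) : dotR (x + y) w = dotR x w + dotR y w := by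
  simp [dotR, add_mul, Finset.sum_add_distrib]

lemma dotR_smul_left (c : ℝ) (x w : Fin N → ℝ) : dotR (c • x) w = c * dotR x w := by
  simp [dotR, mul_assoc, Finset.mul_sum]

lemma dotC_add_left (m m' : Fin N → ℂ) (w : Fin N → ℝ) :
    dotC (m + m') w = dotC m w + dotC m' w := by
  simp [dotC, add_mul, Finset.sum_add_distrib]

lemma dotC_add_right (m : Fin N → ℂ) (v w : Fin N → ℝ) :
    dotC m (v + w) = dotC m v + dotC m w := by
  simp [dotC, mul_add, Finset.sum_add_distrib]

lemma dotC_smul_ofReal (c : ℂ) (v w : Fin N → ℝ) :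
    dotC (c • fun i => (v i : ℂ)) w = c * dotR v w := by
  simp [dotC, dotR, mul_assoc, Finset.mul_sum]

lemma dotR_self_pos {x : Fin N → ℝ} (hx : x ≠ 0) : 0 < dotR x x := by
  obtain ⟨i, hi⟩ := Function.ne_iff.mp hx
  exact Finset.sum_pos' (fun j _ => mul_self_nonneg _) ⟨i, Finset.mem_univ _, mul_self_pos.mpr hi⟩

lemma norm_sq_le_dotR (x : Fin N → ℝ) : ‖x‖ ^ 2 ≤ dotR x x := by
  have h₀ : 0 ≤ dotR x x := Finset.sum_nonneg fun i _ => mul_self_nonneg _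
  refine (Real.le_sqrt (norm_nonneg _) h₀).mp ((pi_norm_le_iff_of_nonneg (Real.sqrt_nonneg _)).mpr
    fun i => Real.le_sqrt_of_sq_le ?_)
  rw [Real.norm_eq_abs, sq_abs, sq]
  exact Finset.single_le_sum (f := fun i => x i * x i) (fun i _ => mul_self_nonneg _)
    (Finset.mem_univ i)

lemma dotR_self_le (x : Fin N → ℝ) : dotR x x ≤ N * ‖x‖ ^ 2 := by
  have : ∀ i ∈ Finset.univ, x i * x i ≤ ‖x‖ ^ 2 := fun i _ => by
    rw [← sq, ← sq_abs]
    exact pow_le_pow_left₀ (abs_nonneg _) (norm_le_pi_norm x i) 2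
  simpa [dotR] using Finset.sum_le_sum this

variable {Λ : Submodule ℤ (Fin N → ℝ)}

lemma discreteTopology_of_even (heven : ∀ w ∈ Λ, ∃ k : ℤ, dotR w w = 2 * k) :
    DiscreteTopology Λ := by
  refine DiscreteTopology.of_forall_le_dist (r := 1 / (N + 1)) (by positivity) fun v w hvw => ?_
  by_contra! hlt
  have hne : ((v - w : Λ) : Fin N → ℝ) ≠ 0 := by
    simpa [sub_eq_zero] using hvw
  obtain ⟨k, hk⟩ := heven _ (v - w).2
  have hpos := dotR_self_pos hne
  have hk1 : (1 : ℝ) ≤ k := by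
    rw [hk] at hpos
    exact_mod_cast (by exact_mod_cast (by linarith : (0 : ℝ) < k) : (0 : ℤ) < k)
  have hle := dotR_self_le ((v - w : Λ) : Fin N → ℝ)
  rw [dist_eq_norm] at hlt
  change ‖((v - w : Λ) : Fin N → ℝ)‖ < _ at hlt
  rw [lt_div_iff₀ (by positivity)] at hlt
  nlinarith [norm_nonneg ((v - w : Λ) : Fin N → ℝ)]

lemma isZLattice_of_selfdual [DiscreteTopology Λ]
    (heven : ∀ w ∈ Λ, ∃ k : ℤ, dotR w w = 2 * k)
    (hselfdual : ∀ x : Fin N → ℝ, (∀ w ∈ Λ, ∃ k : ℤ, dotR x w = k) → x ∈ Λ) :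
    IsZLattice ℝ Λ := by
  refine ⟨?_⟩
  by_contra hne
  obtain ⟨φ, hφ, hker⟩ := Submodule.exists_le_ker_of_lt_top _ (lt_top_iff_ne_top.mpr hne)
  let x : Fin N → ℝ := fun i => φ fun j => if i = j then 1 else 0
  have hdot : ∀ w, dotR x w = φ w := fun w => by
    rw [LinearMap.pi_apply_eq_sum_univ φ w]
    exact Finset.sum_congr rfl fun i _ => mul_comm _ _
  have hx : x ≠ 0 := fun h => hφ (LinearMap.ext fun w => by rw [← hdot w, h]; simp [dotR])
  have hpos := dotR_self_pos hx
  have hmem : (Real.sqrt (dotR x x))⁻¹ • x ∈ Λ := hselfdual _ fun w hw => ⟨0, by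
    have : φ w = 0 := hker (Submodule.subset_span hw)
    rw [dotR_smul_left, hdot w, this]
    simp⟩
  obtain ⟨k, hk⟩ := heven _ hmem
  rw [dotR_smul_left, dotR_comm x (_ • x), dotR_smul_left, ← mul_assoc, ← mul_inv,
    Real.mul_self_sqrt hpos.le, inv_mul_cancel₀ hpos.ne'] at hk
  have : (1 : ℤ) = 2 * k := by exact_mod_cast hk
  omega

lemma tendsto_norm_cofinite_atTop (Λ : Submodule ℤ (Fin N → ℝ)) [DiscreteTopology Λ] :
    Filter.Tendsto (fun w : Λ => ‖w‖) Filter.cofinite Filter.atTop := by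
  have hcl : IsClosed (Λ : Set (Fin N → ℝ)) := @AddSubgroup.isClosed_of_discrete _ _ _ _ _
    Λ.toAddSubgroup (inferInstanceAs (DiscreteTopology Λ))
  rw [Filter.tendsto_atTop]
  intro r
  refine ((Metric.finite_isBounded_inter_isClosed DiscreteTopology.isDiscrete
    (Metric.isBounded_closedBall (x := (0 : Fin N → ℝ)) (r := r)) hcl).preimage_embedding
    (.subtype _)).subset ?_
  intro w hw
  have hw' : ‖w‖ < r := not_le.mp hw
  simpa using hw'.le

lemma summable_thetaLat (Λ : Submodule ℤ (Fin N → ℝ)) [DiscreteTopology Λ] {τ : ℂ}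
    (hτ : 0 < τ.im) (m : Fin N → ℂ) :
    Summable fun w : Λ => cexp (2 * Real.pi * I *
      (τ * (dotR (w : Fin N → ℝ) (w : Fin N → ℝ) : ℂ) / 2 + dotC m (w : Fin N → ℝ))) := by
  let s : ℝ := -(Module.finrank ℤ Λ + 1)
  let C : ℝ := ∑ i, |(m i).im|
  have hO := (rexp_neg_quadratic_isLittleO_rpow_atTop (a := -(Real.pi * τ.im))
    (by have := mul_pos Real.pi_pos hτ; linarith) (2 * Real.pi * C) s).isBigO.comp_tendsto
    (tendsto_norm_cofinite_atTop Λ)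
  refine Summable.of_norm_bounded (summable_of_isBigO
    (ZLattice.summable_norm_rpow Λ s (by simp only [s]; linarith)) hO) fun w => ?_
  rw [Complex.norm_exp]
  simp only [Function.comp]
  apply Real.exp_le_exp.mpr
  have him : (dotC m (w : Fin N → ℝ)).im = ∑ i, (m i).im * (w : Fin N → ℝ) i := by
    simp [dotC]
  have hC : -(C * ‖w‖) ≤ (dotC m (w : Fin N → ℝ)).im := by
    rw [him, Finset.sum_mul, ← Finset.sum_neg_distrib]
    refine Finset.sum_le_sum fun i _ => ?_
    have h₁ := neg_abs_le ((m i).im * (w : Fin N → ℝ) i)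
    rw [abs_mul] at h₁
    have h₂ := mul_le_mul_of_nonneg_left (norm_le_pi_norm (w : Fin N → ℝ) i) (abs_nonneg (m i).im)
    rw [Real.norm_eq_abs] at h₂
    exact (neg_le_neg h₂).trans h₁
  have hre : (2 * Real.pi * I *
      (τ * (dotR (w : Fin N → ℝ) (w : Fin N → ℝ) : ℂ) / 2 + dotC m (w : Fin N → ℝ))).re =
      -(Real.pi * τ.im * dotR (w : Fin N → ℝ) (w : Fin N → ℝ)) -
        2 * Real.pi * (dotC m (w : Fin N → ℝ)).im := by
    rw [show τ * (dotR (w : Fin N → ℝ) (w : Fin N → ℝ) : ℂ) / 2 =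
      ((dotR (w : Fin N → ℝ) (w : Fin N → ℝ) / 2 : ℝ) : ℂ) * τ by push_cast; ring]
    rw [show 2 * (Real.pi : ℂ) * I = ((2 * Real.pi : ℝ) : ℂ) * I by push_cast; ring]
    simp only [mul_re, add_re, add_im, mul_im, ofReal_re, ofReal_im, I_re, I_im]
    ring
  rw [hre]
  have hn := mul_le_mul_of_nonneg_left (norm_sq_le_dotR (w : Fin N → ℝ))
    (mul_pos Real.pi_pos hτ).le
  have hC' := mul_le_mul_of_nonneg_left hC (mul_pos two_pos Real.pi_pos).le
  change _ ≤ -(Real.pi * τ.im) * ‖(w : Fin N → ℝ)‖ ^ 2 + 2 * Real.pi * C * ‖(w : Fin N → ℝ)‖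
  change 2 * Real.pi * -(C * ‖(w : Fin N → ℝ)‖) ≤ _ at hC'
  linarith

end Lattice

section Quasiperiodicity

open Complex

variable {N : ℕ} {τ : ℂ} {f : (Fin N → ℂ) → ℂ}

lemma add_root_of_functionalEquation (hτ : 0 < τ.im) {α : Fin N → ℝ}
    (heq : ∀ m : Fin N → ℂ, ∀ ε₁ ε₂ : ℂ,
      theta1 τ ε₂ * theta1 τ (dotC m α + ε₂) * f (m + ε₁ • (fun i => (α i : ℂ))) -
        theta1 τ ε₁ * theta1 τ (dotC m α + ε₁) * f (m + ε₂ • (fun i => (α i : ℂ))) =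
      theta1 τ (ε₂ - ε₁) * theta1 τ (dotC m α + ε₁ + ε₂) * f m) (m : Fin N → ℂ) :
    f (m + fun i => (α i : ℂ)) = f m := by
  obtain ⟨ε, hε⟩ := exists_theta1_mul_ne_zero hτ (dotC m α)
  have h := heq m 1 ε
  have h₁ : theta1 τ 1 = 0 := by simpa [theta1_zero] using theta1_add_one τ 0
  have h₂ := theta1_add_one τ (ε - 1)
  rw [sub_add_cancel] at h₂
  rw [h₁, one_smul, add_right_comm (dotC m α), theta1_add_one τ (dotC m α + ε)] at h
  refine mul_left_cancel₀ hε ?_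
  linear_combination h - theta1 τ (dotC m α + ε) * f m * h₂

lemma add_tau_root_of_functionalEquation (hτ : 0 < τ.im) {α : Fin N → ℝ} (hα : dotR α α = 2)
    (heq : ∀ m : Fin N → ℂ, ∀ ε₁ ε₂ : ℂ,
      theta1 τ ε₂ * theta1 τ (dotC m α + ε₂) * f (m + ε₁ • (fun i => (α i : ℂ))) -
        theta1 τ ε₁ * theta1 τ (dotC m α + ε₁) * f (m + ε₂ • (fun i => (α i : ℂ))) =
      theta1 τ (ε₂ - ε₁) * theta1 τ (dotC m α + ε₁ + ε₂) * f m) (m : Fin N → ℂ) :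
    f (m + τ • fun i => (α i : ℂ)) =
      cexp (-(2 * Real.pi * I * (τ * (dotR α α : ℂ) / 2 + dotC m α))) * f m := by
  obtain ⟨ε, hε⟩ := exists_theta1_mul_ne_zero hτ (dotC m α)
  have h := heq m τ ε
  have h₁ : theta1 τ τ = 0 := by simpa [theta1_zero] using theta1_add_tau τ 0
  have h₂ := theta1_add_tau τ (ε - τ)
  rw [sub_add_cancel] at h₂
  rw [h₁, add_right_comm (dotC m α), theta1_add_tau τ (dotC m α + ε)] at h
  have h₃ : cexp (-(2 * Real.pi * I * (τ * (dotR α α : ℂ) / 2 + dotC m α))) *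
      cexp (-(Real.pi * I * τ) - 2 * Real.pi * I * (ε - τ)) =
      cexp (-(Real.pi * I * τ) - 2 * Real.pi * I * (dotC m α + ε)) := by
    rw [← Complex.exp_add, hα]
    congr 1
    push_cast
    ring
  refine mul_left_cancel₀ hε ?_
  rw [← h₃] at h
  linear_combination h - cexp (-(2 * Real.pi * I * (τ * (dotR α α : ℂ) / 2 + dotC m α))) *
    theta1 τ (dotC m α + ε) * f m * h₂

lemma add_mem_span_of_forall_add {S : Set (Fin N → ℝ)}
    (h : ∀ α ∈ S, ∀ m, f (m + fun i => (α i : ℂ)) = f m) {w : Fin N → ℝ}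
    (hw : w ∈ Submodule.span ℤ S) : ∀ m, f (m + fun i => (w i : ℂ)) = f m := by
  rw [← Submodule.mem_toAddSubgroup, Submodule.span_int_eq_addSubgroupClosure] at hw
  induction hw using AddSubgroup.closure_induction with
  | mem α hα => exact h α hα
  | zero => intro m; congr 1; ext i; simp
  | add v w _ _ hv hw =>
    intro m
    have : (m + fun i => (((v + w) i : ℝ) : ℂ)) =
        (m + fun i => (v i : ℂ)) + fun i => (w i : ℂ) := by
      ext i; simp [add_assoc]
    rw [this, hw, hv]
  | neg w _ hw =>
    intro m
    rw [← hw]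
    congr 1; ext i; simp

lemma add_tau_mem_span_of_forall_add {S : Set (Fin N → ℝ)}
    (h : ∀ α ∈ S, ∀ m, f (m + τ • fun i => (α i : ℂ)) =
      cexp (-(2 * Real.pi * I * (τ * (dotR α α : ℂ) / 2 + dotC m α))) * f m) {w : Fin N → ℝ}
    (hw : w ∈ Submodule.span ℤ S) : ∀ m, f (m + τ • fun i => (w i : ℂ)) =
      cexp (-(2 * Real.pi * I * (τ * (dotR w w : ℂ) / 2 + dotC m w))) * f m := by
  rw [← Submodule.mem_toAddSubgroup, Submodule.span_int_eq_addSubgroupClosure] at hw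
  induction hw using AddSubgroup.closure_induction with
  | mem α hα => exact h α hα
  | zero =>
    intro m
    have : m + τ • (fun i => (((0 : Fin N → ℝ) i : ℝ) : ℂ)) = m := by ext i; simp
    rw [this]
    simp [dotR, dotC]
  | add v w _ _ hv hw =>
    intro m
    have : m + τ • (fun i => (((v + w) i : ℝ) : ℂ)) =
        (m + τ • fun i => (v i : ℂ)) + τ • fun i => (w i : ℂ) := by
      ext i; simp; ring
    rw [this, hw, hv, ← mul_assoc, ← Complex.exp_add, dotC_add_left, dotC_add_right,
      dotC_smul_ofReal, dotR_add_left, dotR_comm v (v + w), dotR_comm w (v + w), dotR_add_left,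
      dotR_add_left, dotR_comm w v]
    congr 2
    push_cast
    ring
  | neg w _ hw =>
    intro m
    have h₁ : (m + τ • fun i => (((-w) i : ℝ) : ℂ)) + τ • (fun i => (w i : ℂ)) = m := by
      ext i; simp
    have h₂ : (fun i => (((-w) i : ℝ) : ℂ)) = -fun i => (w i : ℂ) := by ext i; simp
    have h₃ : dotR (-w) (-w) = dotR w w := by simp [dotR]
    have h₄ : dotC m (-w) = -dotC m w := by simp [dotC]
    have h₅ : dotC (m + τ • fun i => (((-w) i : ℝ) : ℂ)) w = dotC m w - τ * dotR w w := by
      rw [dotC_add_left, dotC_smul_ofReal, ← neg_one_smul ℝ w, dotR_smul_left]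
      push_cast
      ring
    have h₆ := hw (m + τ • fun i => (((-w) i : ℝ) : ℂ))
    rw [h₁, h₅] at h₆
    rw [h₃, h₄, h₆, ← mul_assoc, ← Complex.exp_add]
    conv_lhs => rw [← one_mul (f _), ← Complex.exp_zero]
    congr 2
    ring

end Quasiperiodicity

section Coordinates

open Complex

variable {N : ℕ} {Λ : Submodule ℤ (Fin N → ℝ)}

/-- The complex linear combination with coefficients `z` of a family of real vectors. -/
noncomputable def complexCombination (b : Fin N → Fin N → ℝ) (z : Fin N → ℂ) : Fin N → ℂ :=
  ∑ i, z i • fun j => (b i j : ℂ)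

lemma complexCombination_add (b : Fin N → Fin N → ℝ) (z z' : Fin N → ℂ) :
    complexCombination b (z + z') = complexCombination b z + complexCombination b z' := by
  simp [complexCombination, add_smul, Finset.sum_add_distrib]

lemma complexCombination_smul (b : Fin N → Fin N → ℝ) (c : ℂ) (z : Fin N → ℂ) :
    complexCombination b (c • z) = c • complexCombination b z := by
  simp [complexCombination, Finset.smul_sum, smul_smul]

lemma complexCombination_ofReal (b : Fin N → Fin N → ℝ) (x : Fin N → ℝ) :
    complexCombination b (fun i => (x i : ℂ)) = fun j => ((∑ i, x i • b i) j : ℂ) := by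
  ext j
  simp [complexCombination]

lemma dotC_complexCombination (b : Fin N → Fin N → ℝ) (z : Fin N → ℂ) (w : Fin N → ℝ) :
    dotC (complexCombination b z) w = ∑ i, (dotR w (b i) : ℂ) * z i := by
  simp only [dotC, dotR, complexCombination, Finset.sum_apply, Pi.smul_apply, smul_eq_mul,
    Finset.sum_mul, ofReal_sum, ofReal_mul]
  rw [Finset.sum_comm]
  exact Finset.sum_congr rfl fun i _ => Finset.sum_congr rfl fun j _ => by ring

lemma complexCombination_surjective (b : Module.Basis (Fin N) ℝ (Fin N → ℝ)) :
    Function.Surjective (complexCombination b) := by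
  intro m
  refine ⟨(fun i => ((b.repr fun j => (m j).re) i : ℂ)) +
    I • fun i => ((b.repr fun j => (m j).im) i : ℂ), ?_⟩
  rw [complexCombination_add, complexCombination_smul, complexCombination_ofReal,
    complexCombination_ofReal, b.sum_repr, b.sum_repr]
  ext j
  simp [mul_comm I, re_add_im]

lemma differentiable_complexCombination (b : Fin N → Fin N → ℝ) :
    Differentiable ℂ (complexCombination b) := by
  unfold complexCombination
  fun_prop

/-- A self-dual lattice is identified with `ℤ^N` by pairing with a basis. -/
lemma exists_equiv_dotR_basis [DiscreteTopology Λ] [IsZLattice ℝ Λ]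
    (hintegral : ∀ v ∈ Λ, ∀ w ∈ Λ, ∃ k : ℤ, dotR v w = k)
    (hselfdual : ∀ x : Fin N → ℝ, (∀ w ∈ Λ, ∃ k : ℤ, dotR x w = k) → x ∈ Λ)
    (b : Module.Basis (Fin N) ℤ Λ) :
    ∃ e : Λ ≃ (Fin N → ℤ), ∀ (w : Λ) i, dotR (w : Fin N → ℝ) (b i : Fin N → ℝ) = e w i := by
  choose e he using fun (w : Λ) (i : Fin N) => hintegral w w.2 (b i) (b i).2
  let bR := b.ofZLatticeBasis ℝ Λ
  have hbR : ∀ i, bR i = b i := b.ofZLatticeBasis_apply ℝ Λ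
  let φ : (Fin N → ℝ) →ₗ[ℝ] (Fin N → ℝ) :=
    { toFun := fun x i => dotR x (bR i)
      map_add' := fun x y => funext fun i => dotR_add_left x y _
      map_smul' := fun c x => funext fun i => dotR_smul_left c x _ }
  have hφ : Function.Injective φ := by
    rw [injective_iff_map_eq_zero]
    intro x hx
    by_contra hne
    refine (dotR_self_pos hne).ne' ?_
    let ψ : (Fin N → ℝ) →ₗ[ℝ] ℝ :=
      { toFun := fun y => dotR y x
        map_add' := fun y z => dotR_add_left y z x
        map_smul' := fun c y => dotR_smul_left c y x }
    have : ψ = 0 := bR.ext fun i => (dotR_comm _ _).trans (congrFun hx i)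
    exact LinearMap.congr_fun this x
  refine ⟨Equiv.ofBijective e ⟨fun v w hvw => ?_, fun n => ?_⟩, he⟩
  · refine Subtype.ext (hφ (funext fun i => ?_))
    change dotR _ (bR i) = dotR _ (bR i)
    rw [hbR, he, he, hvw]
  · obtain ⟨x, hx⟩ := LinearMap.surjective_of_injective hφ fun i => (n i : ℝ)
    have hx' : ∀ i, dotR x (b i) = n i := fun i => by
      rw [← hbR]
      exact congrFun hx i
    have hmem : x ∈ Λ := by
      refine hselfdual x fun w hw => ⟨∑ i, b.repr ⟨w, hw⟩ i * n i, ?_⟩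
      have hsum : w = ∑ i, (b.repr ⟨w, hw⟩ i : ℝ) • (b i : Fin N → ℝ) := by
        conv_lhs => rw [show w = ((⟨w, hw⟩ : Λ) : Fin N → ℝ) from rfl, ← b.sum_repr ⟨w, hw⟩]
        simp only [Int.cast_smul_eq_zsmul]
        push_cast
        rfl
      let ψ : (Fin N → ℝ) →ₗ[ℝ] ℝ :=
        { toFun := fun y => dotR y x
          map_add' := fun y z => dotR_add_left y z x
          map_smul' := fun c y => dotR_smul_left c y x }
      have hψ : dotR x w = ψ w := dotR_comm _ _
      rw [hψ]
      conv_lhs => rw [hsum, map_sum]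
      push_cast
      refine Finset.sum_congr rfl fun i _ => ?_
      rw [map_smul, ← hx' i, dotR_comm x]
      rfl
    refine ⟨⟨x, hmem⟩, funext fun i => ?_⟩
    have := (he ⟨x, hmem⟩ i).symm.trans (hx' i)
    exact_mod_cast this

end Coordinates

/-- If Λ is a positive definite even unimodular lattice generated by its roots
(realised as a self-dual even lattice in ℝ^N with the standard dot product),
and f is holomorphic on Λ⊗ℂ ≅ ℂ^N satisfying the functional equation for every
root α, then f is a multiple of the theta series of Λ. -/
theorem statement0 {N : ℕ} (Λ : Submodule ℤ (Fin N → ℝ))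
    (heven : ∀ w ∈ Λ, ∃ k : ℤ, dotR w w = 2 * k)
    (hintegral : ∀ v ∈ Λ, ∀ w ∈ Λ, ∃ k : ℤ, dotR v w = k)
    (hselfdual : ∀ x : Fin N → ℝ, (∀ w ∈ Λ, ∃ k : ℤ, dotR x w = k) → x ∈ Λ)
    (hroots : Submodule.span ℤ {α : Fin N → ℝ | α ∈ Λ ∧ dotR α α = 2} = Λ)
    (τ : ℂ) (hτ : 0 < τ.im)
    (f : (Fin N → ℂ) → ℂ) (hf : Differentiable ℂ f)
    (heq : ∀ α ∈ Λ, dotR α α = 2 → ∀ m : Fin N → ℂ, ∀ ε₁ ε₂ : ℂ,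
      theta1 τ ε₂ * theta1 τ (dotC m α + ε₂) * f (m + ε₁ • (fun i => (α i : ℂ))) -
        theta1 τ ε₁ * theta1 τ (dotC m α + ε₁) * f (m + ε₂ • (fun i => (α i : ℂ))) =
      theta1 τ (ε₂ - ε₁) * theta1 τ (dotC m α + ε₁ + ε₂) * f m) :
    ∃ c : ℂ, ∀ m : Fin N → ℂ, f m = c * thetaLat Λ τ m := by
  have hdisc : DiscreteTopology Λ := discreteTopology_of_even heven
  have hlat : IsZLattice ℝ Λ := isZLattice_of_selfdual heven hselfdual
  have hadd : ∀ w ∈ Λ, ∀ m, f (m + fun i => (w i : ℂ)) = f m := fun w hw =>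
    add_mem_span_of_forall_add
      (fun α hα => add_root_of_functionalEquation hτ (heq α hα.1 hα.2)) (hroots.symm ▸ hw)
  have haddτ : ∀ w ∈ Λ, ∀ m, f (m + τ • fun i => (w i : ℂ)) =
      Complex.exp (-(2 * Real.pi * Complex.I * (τ * (dotR w w : ℂ) / 2 + dotC m w))) * f m :=
    fun w hw => add_tau_mem_span_of_forall_add
      (fun α hα => add_tau_root_of_functionalEquation hτ hα.2 (heq α hα.1 hα.2))
      (hroots.symm ▸ hw)
  let b := IsZLattice.basis Λ
  let B : (Fin N → ℂ) → Fin N → ℂ := complexCombination fun i => (b i : Fin N → ℝ)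
  have hbR : ⇑(b.ofZLatticeBasis ℝ Λ) = fun i => (b i : Fin N → ℝ) :=
    funext (b.ofZLatticeBasis_apply ℝ Λ)
  have hBsurj : Function.Surjective B := by
    have := complexCombination_surjective (b.ofZLatticeBasis ℝ Λ)
    rwa [hbR] at this
  have hBint : ∀ k : Fin N → ℤ, B (fun i => (k i : ℂ)) =
      fun j => (((∑ i, k i • b i : Λ) : Fin N → ℝ) j : ℂ) := by
    intro k
    have := complexCombination_ofReal (fun i => (b i : Fin N → ℝ)) fun i => (k i : ℝ)
    simpa using this
  obtain ⟨e, he⟩ := exists_equiv_dotR_basis hintegral hselfdual b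
  have hdot : ∀ (z : Fin N → ℂ) (w : Λ), dotC (B z) w = ∑ i, (e w i : ℂ) * z i := fun z w => by
    simp [B, dotC_complexCombination, he]
  let F : (Fin N → ℂ) → ℂ := fun z => f (B z)
  have hF : Differentiable ℂ F := hf.comp (differentiable_complexCombination _)
  have hper : ∀ (z : Fin N → ℂ) (k : Fin N → ℤ), F (z + fun i => (k i : ℂ)) = F z := by
    intro z k
    simp only [F, B, complexCombination_add]
    exact (congrArg (fun v => f (B z + v)) (hBint k)).trans (hadd _ (Subtype.coe_prop _) _)
  have hcoeff : ∀ w : Λ, periodicCoeff F (e w) = periodicCoeff F 0 *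
      Complex.exp (2 * Real.pi * Complex.I * (τ * (dotR (w : Fin N → ℝ) w : ℂ) / 2)) := by
    intro w
    have hw : B (fun i => (b.repr w i : ℂ)) = fun j => ((w : Fin N → ℝ) j : ℂ) := by
      rw [hBint, b.sum_repr]
    have h := periodicCoeff_of_quasiperiodic hF hper (w := τ • fun i => (b.repr w i : ℂ))
      (n := e w) (A := Complex.exp
        (-(2 * Real.pi * Complex.I * (τ * (dotR (w : Fin N → ℝ) w : ℂ) / 2)))) fun z => by
        simp only [F, B, complexCombination_add, complexCombination_smul]
        change f (B z + τ • B _) = _ * (_ * f (B z))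
        rw [hw, haddτ w w.2, hdot, ← mul_assoc, ← Complex.exp_add]
        congr 2
        ring
    rw [h, mul_right_comm, ← Complex.exp_add, neg_add_cancel, Complex.exp_zero, one_mul]
  refine ⟨periodicCoeff F 0, fun m => ?_⟩
  obtain ⟨z, rfl⟩ := hBsurj m
  have hterm : (fun n => periodicCoeff F n *
      Complex.exp (2 * Real.pi * Complex.I * ∑ i, (n i : ℂ) * z i)) ∘ e = fun w : Λ =>
      periodicCoeff F 0 * Complex.exp (2 * Real.pi * Complex.I *
        (τ * (dotR (w : Fin N → ℝ) (w : Fin N → ℝ) : ℂ) / 2 + dotC (B z) (w : Fin N → ℝ))) := by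
    funext w
    rw [Function.comp_apply, hcoeff, mul_assoc, ← Complex.exp_add, hdot, mul_add]
  have hs := (summable_thetaLat Λ hτ (B z)).mul_left (periodicCoeff F 0)
  rw [← hterm, e.summable_iff] at hs
  have hsum := e.hasSum_iff.mpr (hasSum_periodicCoeff hF hper z hs)
  rw [hterm] at hsum
  rw [thetaLat, ← tsum_mul_left]
  exact hsum.tsum_eq.symm
end

section
/- Fix R ∈ (1/2)ℤ. Let J be a finite set of pairs (j_L, j_R) of nonnegative half-integers such that 2j_L + 2j_R + 1 ≡ 2R (mod 2) for every (j_L,j_R) ∈ J, and let x_{(j_L,j_R)} ∈ ℂ be coefficients such that ∑_{(j_L,j_R)∈J} x_{(j_L,j_R)} · Bl_{(j_L,j_R,R)}(ε₁,ε₂) = 0 for all (ε₁,ε₂) in a nonempty open subset of ℂ² on which all these meromorphic functions are defined. Then x_{(j_L,j_R)} = 0 for every (j_L,j_R) ∈ J, with the only possible exceptions being the coefficient of (j_L,j_R) = (0,0) when R = 1/2 or R = −1/2, and the coefficient of (j_L,j_R) = (0,1/2) when R = 0 (these correspond to the identically vanishing functions Bl_{(0,0,±1/2)} and Bl_{(0,1/2,0)}).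 -/
/-- The SU(2) character χ_j(q) for spin j = n/2, n ∈ ℕ:
χ_j(q) = ∑_{k=0}^{2j} q^{2j−2k}. -/
noncomputable def chiSU2 (n : ℕ) (q : ℂ) : ℂ :=
  ∑ k ∈ Finset.range (n + 1), q ^ ((n : ℤ) - 2 * (k : ℤ))

/-- The function f_{(j_L,j_R)}(ε₁,ε₂) with j_L = nL/2, j_R = nR/2. -/
noncomputable def fLR (nL nR : ℕ) (ε₁ ε₂ : ℂ) : ℂ :=
  chiSU2 nL (Complex.exp (Real.pi * Complex.I * (ε₁ - ε₂))) *
    chiSU2 nR (Complex.exp (Real.pi * Complex.I * (ε₁ + ε₂))) /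
  ((Complex.exp (Real.pi * Complex.I * ε₁) - Complex.exp (-(Real.pi * Complex.I * ε₁))) *
   (Complex.exp (Real.pi * Complex.I * ε₂) - Complex.exp (-(Real.pi * Complex.I * ε₂))))

/-- The function Bl_{(j_L,j_R,R)}(ε₁,ε₂) with j_L = nL/2, j_R = nR/2, R = r/2. -/
noncomputable def Bl (nL nR : ℕ) (r : ℤ) (ε₁ ε₂ : ℂ) : ℂ :=
  fLR nL nR ε₁ (ε₂ - ε₁) * Complex.exp (Real.pi * Complex.I * (r : ℂ) * ε₁) +
  fLR nL nR (ε₁ - ε₂) ε₂ * Complex.exp (Real.pi * Complex.I * (r : ℂ) * ε₂) -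
  fLR nL nR ε₁ ε₂

/-- The coefficient of `a ^ s * b ^ t` in the Laurent polynomial
`(a - a⁻¹) (b - b⁻¹) (a / b - b / a) * Bl`, where `a = exp (π i ε₁)`, `b = exp (π i ε₂)`. -/
def blCoeff (r : ℤ) (p : ℕ × ℕ) (s t : ℤ) : ℤ :=
  -(if -(p.1 : ℤ) ≤ p.2 + 1 - t ∧ p.2 + 1 - t ≤ p.1 ∧ ((p.2 + 1 - t) - p.1) % 2 = 0 ∧
      s = r + 2 * (p.2 + 1 - t) then 1 else 0) +
  (if -(p.1 : ℤ) ≤ -(p.2 + 1) - t ∧ -(p.2 + 1) - t ≤ p.1 ∧ ((-(p.2 + 1) - t) - p.1) % 2 = 0 ∧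
      s = r + 2 * (-(p.2 + 1) - t) then 1 else 0) +
  (if -(p.1 : ℤ) ≤ s - (p.2 + 1) ∧ s - (p.2 + 1) ≤ p.1 ∧ ((s - (p.2 + 1)) - p.1) % 2 = 0 ∧
      t = r - 2 * (s - (p.2 + 1)) then 1 else 0) -
  (if -(p.1 : ℤ) ≤ s + (p.2 + 1) ∧ s + (p.2 + 1) ≤ p.1 ∧ ((s + (p.2 + 1)) - p.1) % 2 = 0 ∧
      t = r - 2 * (s + (p.2 + 1)) then 1 else 0) -
  (if -(p.2 : ℤ) ≤ s - (p.1 + 1) ∧ s - (p.1 + 1) ≤ p.2 ∧ ((s - (p.1 + 1)) - p.2) % 2 = 0 ∧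
      t = s - 2 * (p.1 + 1) then 1 else 0) +
  (if -(p.2 : ℤ) ≤ s + (p.1 + 1) ∧ s + (p.1 + 1) ≤ p.2 ∧ ((s + (p.1 + 1)) - p.2) % 2 = 0 ∧
      t = s + 2 * (p.1 + 1) then 1 else 0)

lemma blCoeff_neg (r : ℤ) (p : ℕ × ℕ) (s t : ℤ) :
    blCoeff (-r) p (-s) (-t) = -blCoeff r p s t := by
  obtain ⟨n, m⟩ := p
  have key : ∀ (P Q : Prop) [Decidable P] [Decidable Q], (P ↔ Q) →
      (if P then (1 : ℤ) else 0) = if Q then 1 else 0 := fun P Q _ _ h => by simp [h]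
  simp only [blCoeff]
  rw [key (-(n : ℤ) ≤ m + 1 - -t ∧ _) (-(n : ℤ) ≤ -(m + 1) - t ∧ -(m + 1) - t ≤ n ∧
        ((-(m + 1) - t) - n) % 2 = 0 ∧ s = r + 2 * (-(m + 1) - t)) (by omega),
    key (-(n : ℤ) ≤ -(m + 1) - -t ∧ _) (-(n : ℤ) ≤ m + 1 - t ∧ m + 1 - t ≤ n ∧
        ((m + 1 - t) - n) % 2 = 0 ∧ s = r + 2 * (m + 1 - t)) (by omega),
    key (-(n : ℤ) ≤ -s - (m + 1) ∧ _) (-(n : ℤ) ≤ s + (m + 1) ∧ s + (m + 1) ≤ n ∧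
        ((s + (m + 1)) - n) % 2 = 0 ∧ t = r - 2 * (s + (m + 1))) (by omega),
    key (-(n : ℤ) ≤ -s + (m + 1) ∧ _) (-(n : ℤ) ≤ s - (m + 1) ∧ s - (m + 1) ≤ n ∧
        ((s - (m + 1)) - n) % 2 = 0 ∧ t = r - 2 * (s - (m + 1))) (by omega),
    key (-(m : ℤ) ≤ -s - (n + 1) ∧ _) (-(m : ℤ) ≤ s + (n + 1) ∧ s + (n + 1) ≤ m ∧
        ((s + (n + 1)) - m) % 2 = 0 ∧ t = s + 2 * (n + 1)) (by omega),
    key (-(m : ℤ) ≤ -s + (n + 1) ∧ _) (-(m : ℤ) ≤ s - (n + 1) ∧ s - (n + 1) ≤ m ∧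
        ((s - (n + 1)) - m) % 2 = 0 ∧ t = s - 2 * (n + 1)) (by omega)]
  ring

lemma blCoeff_zero_of_positive {N n m k : ℕ} (hk : k + 1 < N) (h1 : n ≤ N)
    (h2 : n + m + 1 ≤ 2 * N) (h3 : (n + m + 1 : ℤ) % 2 = 0) :
    blCoeff 0 (n, m) (2 * N) (2 * N - 2 - 2 * k) =
      if (n, m) = (k, 2 * N - 1 - k) then -1 else 0 := by
  simp only [blCoeff, Prod.mk.injEq]
  split_ifs <;> omega

set_option maxHeartbeats 1000000 in
lemma blCoeff_zero_middle {N n m : ℕ} (hN : 1 ≤ N) (h1 : n ≤ N) (h2 : n + m + 1 ≤ 2 * N)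
    (h3 : (n + m + 1 : ℤ) % 2 = 0) :
    blCoeff 0 (n, m) (2 * N) 0 = -(if (n, m) = (N, N - 1) then 1 else 0) +
      (if (n, m) = (0, 2 * N - 1) then 1 else 0) - (if (n, m) = (N - 1, N) then 1 else 0) := by
  simp only [blCoeff, Prod.mk.injEq]
  split_ifs <;> omega

lemma blCoeff_zero_bottom {N n m : ℕ} (hN : 1 < N) (h1 : n ≤ N) (h2 : n + m + 1 ≤ 2 * N)
    (h3 : (n + m + 1 : ℤ) % 2 = 0) :
    blCoeff 0 (n, m) (2 * N) (-(2 * N)) = if (n, m) = (N, N - 1) then 2 else 0 := by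
  simp only [blCoeff, Prod.mk.injEq]
  split_ifs <;> omega

lemma blCoeff_top_of_lt {r : ℤ} {N M D n m : ℕ} (hD : D < r + 2 * N) (h1 : n ≤ N)
    (h2 : n + m + 1 ≤ D) :
    blCoeff r (n, m) (r + 2 * N) (-N - (M + 1)) = if (n, m) = (N, M) then 1 else 0 := by
  simp only [blCoeff, Prod.mk.injEq]
  split_ifs <;> omega

lemma blCoeff_bottom_of_lt {r : ℤ} {N D k l n m : ℕ} (hD : 2 * N - r < D) (hr : 2 < r + D)
    (hkl : k + l + 1 = D) (h1 : n ≤ N) (h2 : n + m + 1 ≤ D) (h3 : n + m + 1 = D → n ≤ k) :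
    blCoeff r (n, m) (-D) (r + 2 * k) = if (n, m) = (k, l) then -1 else 0 := by
  simp only [blCoeff, Prod.mk.injEq]
  split_ifs <;> omega

/-- If on the support of `x` only `p₀` contributes to the coefficient at `(s, t)`, and this
coefficient vanishes, then `x p₀ = 0`. -/
lemma eq_zero_of_coeff_eq_single {r : ℤ} {J : Finset (ℕ × ℕ)} {x : ℕ × ℕ → ℂ} {s t : ℤ}
    (h : ∑ p ∈ J, x p * (blCoeff r p s t : ℂ) = 0) {p₀ : ℕ × ℕ} (hp₀ : x p₀ ≠ 0 → p₀ ∈ J)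
    {c : ℤ} (hc : c ≠ 0)
    (hsingle : ∀ p ∈ J, x p ≠ 0 → blCoeff r p s t = if p = p₀ then c else 0) : x p₀ = 0 := by
  by_contra hx
  have : ∑ p ∈ J, x p * (blCoeff r p s t : ℂ) = ∑ p ∈ J, if p = p₀ then x p * c else 0 := by
    refine Finset.sum_congr rfl fun p hp => ?_
    by_cases hxp : x p = 0
    · simp [hxp]
    · rw [hsingle p hp hxp]
      split_ifs <;> simp
  rw [this, Finset.sum_ite_eq', if_pos (hp₀ hx)] at h
  exact hx ((mul_eq_zero.mp h).resolve_right (by exact_mod_cast hc))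

/-- The case where the support of `x` reaches the critical line `n + m + 1 = 2 * N`, `r = 0`. -/
lemma critical_line_false {J : Finset (ℕ × ℕ)} {x : ℕ × ℕ → ℂ}
    (hJ : ∀ p ∈ J, ((p.1 : ℤ) + (p.2 : ℤ) + 1) % 2 = 0) (hx : ∀ p, x p ≠ 0 → p ∈ J)
    (h : ∀ s t : ℤ, ∑ p ∈ J, x p * (blCoeff 0 p s t : ℂ) = 0) {N : ℕ}
    (hN : ∀ p, x p ≠ 0 → p.1 ≤ N) (hD : ∀ p, x p ≠ 0 → p.1 + p.2 + 1 ≤ 2 * N)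
    {p q : ℕ × ℕ} (hp : x p ≠ 0) (hpN : p.1 = N) (hq : x q ≠ 0)
    (hqD : q.1 + q.2 + 1 = 2 * N) : False := by
  have hN1 : 1 ≤ N := by omega
  have hlow : ∀ k, k + 1 < N → x (k, 2 * N - 1 - k) = 0 := fun k hk => by
    refine eq_zero_of_coeff_eq_single (h (2 * N) (2 * N - 2 - 2 * k)) (hx _) (c := -1)
      (by norm_num) ?_
    exact fun p hp hxp => blCoeff_zero_of_positive hk (hN p hxp) (hD p hxp) (hJ p hp)
  have hmid : -x (N, N - 1) + x (0, 2 * N - 1) - x (N - 1, N) = 0 := by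
    have e : ∀ p ∈ J, x p * (blCoeff 0 p (2 * N) 0 : ℂ) =
        -(if p = (N, N - 1) then x p else 0) + (if p = (0, 2 * N - 1) then x p else 0)
          - (if p = (N - 1, N) then x p else 0) := by
      rintro ⟨n, m⟩ hp
      by_cases hxp : x (n, m) = 0
      · simp [hxp]
      rw [blCoeff_zero_middle hN1 (hN _ hxp) (hD _ hxp) (hJ _ hp)]
      push_cast
      simp only [mul_add, mul_sub, mul_neg, mul_ite, mul_one, mul_zero]
    have hs := h (2 * N) 0
    have hmem : ∀ p, (if p ∈ J then x p else 0) = x p := fun p => by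
      by_cases hxp : x p = 0
      · simp [hxp]
      · simp [hx p hxp]
    rw [Finset.sum_congr rfl e] at hs
    simpa [Finset.sum_add_distrib, Finset.sum_sub_distrib, hmem] using hs
  rcases Nat.lt_or_ge 1 N with hN2 | hN2
  · have htop : x (N, N - 1) = 0 := by
      refine eq_zero_of_coeff_eq_single (h (2 * N) (-(2 * N))) (hx _) (c := 2) (by norm_num) ?_
      exact fun p hp hxp => blCoeff_zero_bottom hN2 (hN p hxp) (hD p hxp) (hJ p hp)
    have h0 := hlow 0 (by omega)
    simp only [Nat.sub_zero] at h0
    have hsub : x (N - 1, N) = 0 := by simpa [htop, h0] using hmid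
    have hqN := hN q hq
    obtain ⟨n, m⟩ := q
    simp only at *
    rcases (by omega : n + 1 < N ∨ n = N - 1 ∨ n = N) with hn | hn | hn
    · exact hq (by rw [← hlow n hn]; congr; omega)
    · exact hq (by rw [← hsub, hn]; congr; omega)
    · exact hq (by rw [← htop, hn]; congr; omega)
  · obtain rfl : N = 1 := by omega
    have hpD := hD p hp
    obtain ⟨n, m⟩ := p
    simp only at *
    obtain ⟨rfl, rfl⟩ : n = 1 ∧ m = 0 := by omega
    exact hp (by simpa using hmid)

lemma support_exceptional_of_nonneg {r : ℤ} (hr : 0 ≤ r) {J : Finset (ℕ × ℕ)} {x : ℕ × ℕ → ℂ}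
    (hJ : ∀ p ∈ J, ((p.1 : ℤ) + (p.2 : ℤ) + 1) % 2 = r % 2) (hx : ∀ p, x p ≠ 0 → p ∈ J)
    (h : ∀ s t : ℤ, ∑ p ∈ J, x p * (blCoeff r p s t : ℂ) = 0) {p : ℕ × ℕ} (hp : x p ≠ 0) :
    (p = (0, 0) ∧ r = 1) ∨ (p = (0, 1) ∧ r = 0) := by
  have hne : (J.filter (x · ≠ 0)).Nonempty := ⟨p, by simp [hp, hx p hp]⟩
  obtain ⟨a, ha, haN⟩ := Finset.exists_max_image _ (fun p : ℕ × ℕ => p.1) hne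
  obtain ⟨b, hb, hbD⟩ := Finset.exists_max_image _ (fun p : ℕ × ℕ => p.1 + p.2 + 1) hne
  simp only [Finset.mem_filter, and_imp] at ha hb haN hbD
  replace haN : ∀ p, x p ≠ 0 → p.1 ≤ a.1 := fun p hp => haN p (hx p hp) hp
  replace hbD : ∀ p, x p ≠ 0 → p.1 + p.2 + 1 ≤ b.1 + b.2 + 1 := fun p hp => hbD p (hx p hp) hp
  have hpar := hJ b hb.1
  by_cases hhigh : (b.1 + b.2 + 1 : ℤ) < r + 2 * a.1
  · refine absurd (eq_zero_of_coeff_eq_single (h (r + 2 * a.1) (-a.1 - (a.2 + 1))) (hx a)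
      one_ne_zero ?_) ha.2
    exact fun q _ hxq => blCoeff_top_of_lt (by exact_mod_cast hhigh) (haN q hxq) (hbD q hxq)
  by_cases hlow : (2 * a.1 - r : ℤ) < b.1 + b.2 + 1
  · by_cases hexc : r + (b.1 + b.2 + 1) = 2
    · have h1 := haN _ hp
      have h2 := hbD _ hp
      have h3 := hJ _ (hx _ hp)
      obtain ⟨n, m⟩ := p
      simp only [Prod.mk.injEq] at *
      omega
    · have hne' : (J.filter fun q => x q ≠ 0 ∧ q.1 + q.2 = b.1 + b.2).Nonempty :=
        ⟨b, by simp [hb]⟩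
      obtain ⟨c, hc, hcN⟩ := Finset.exists_max_image _ (fun p : ℕ × ℕ => p.1) hne'
      simp only [Finset.mem_filter, and_imp] at hc hcN
      refine absurd (eq_zero_of_coeff_eq_single (h (-(b.1 + b.2 + 1 : ℕ)) (r + 2 * c.1)) (hx c)
        (c := -1) (by norm_num) ?_) hc.2.1
      exact fun q hq hxq => blCoeff_bottom_of_lt (by exact_mod_cast hlow) (by omega)
        (by omega) (haN q hxq) (hbD q hxq) fun hqD => hcN q hq hxq (by omega)
  · obtain rfl : r = 0 := by omega
    exact (critical_line_false hJ hx h haN (fun p hp => by have := hbD p hp; omega) ha.2 rfl hb.2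
      (by omega)).elim

open Complex in
/-- The exponential monomial `a ^ s * b ^ t` in `a = exp (π i ε₁)`, `b = exp (π i ε₂)`. -/
noncomputable def expMonomial (v : ℤ × ℤ) (ε : ℂ × ℂ) : ℂ :=
  exp (Real.pi * I * (v.1 * ε.1 + v.2 * ε.2))

lemma expMonomial_injective : Function.Injective expMonomial := by
  intro v w h
  have hd : ∀ v : ℤ × ℤ, ∀ u : ℂ × ℂ,
      HasDerivAt (fun z : ℂ => expMonomial v (z * u.1, z * u.2))
        (Real.pi * Complex.I * (v.1 * u.1 + v.2 * u.2)) 0 := fun v u => by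
    have h1 : HasDerivAt (fun z : ℂ => Real.pi * Complex.I * (v.1 * (z * u.1) + v.2 * (z * u.2)))
        (Real.pi * Complex.I * (v.1 * (1 * u.1) + v.2 * (1 * u.2))) 0 :=
      ((((hasDerivAt_id (0 : ℂ)).mul_const u.1).const_mul _).add
        (((hasDerivAt_id (0 : ℂ)).mul_const u.2).const_mul _)).const_mul _
    simpa [expMonomial] using h1.cexp
  have hu : ∀ u : ℂ × ℂ, (v.1 * u.1 + v.2 * u.2 : ℂ) = w.1 * u.1 + w.2 * u.2 := fun u => by
    have h1 := hd v u
    rw [h] at h1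
    exact mul_left_cancel₀ (by simp [Real.pi_ne_zero]) (h1.unique (hd w u))
  ext
  · simpa using hu (1, 0)
  · simpa using hu (0, 1)

lemma linearIndependent_expMonomial : LinearIndependent ℂ expMonomial := by
  let φ : ℤ × ℤ → Multiplicative (ℂ × ℂ) →* ℂ := fun v =>
    { toFun := fun ε => expMonomial v ε.toAdd
      map_one' := by simp [expMonomial]
      map_mul' := fun x y => by
        simp only [expMonomial, ← Complex.exp_add, toAdd_mul, Prod.fst_add, Prod.snd_add]
        ring_nf }
  have hφ : Function.Injective φ := fun v w h => expMonomial_injective <| funext fun ε =>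
    DFunLike.congr_fun h (Multiplicative.ofAdd ε)
  exact (linearIndependent_monoidHom (Multiplicative (ℂ × ℂ)) ℂ).comp φ hφ

/-- A linear combination of exponential monomials that vanishes on a nonempty open set is trivial. -/
lemma eq_zero_of_linearCombination_expMonomial {c : ℤ × ℤ →₀ ℂ} {U : Set (ℂ × ℂ)} (hU : IsOpen U)
    (hne : U.Nonempty) (h : ∀ ε ∈ U, Finsupp.linearCombination ℂ expMonomial c ε = 0) : c = 0 := by
  obtain ⟨ε₀, hε₀⟩ := hne
  have han : AnalyticOnNhd ℂ (Finsupp.linearCombination ℂ expMonomial c) Set.univ := by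
    rw [Finsupp.linearCombination_apply, Finsupp.sum]
    refine Finset.analyticOnNhd_sum _ fun v _ ε _ => ?_
    exact analyticAt_const.smul (analyticAt_const.mul
      ((analyticAt_const.mul analyticAt_fst).add (analyticAt_const.mul analyticAt_snd))).cexp
  refine linearIndependent_iff.mp linearIndependent_expMonomial c (funext fun ε => ?_)
  exact han.eqOn_zero_of_preconnected_of_eventuallyEq_zero isPreconnected_univ (Set.mem_univ ε₀)
    (Filter.eventually_of_mem (hU.mem_nhds hε₀) h) (Set.mem_univ ε)

/-- The numerator `(a - a⁻¹) (b - b⁻¹) (a / b - b / a) * Bl` as a formal Laurent polynomial. -/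
noncomputable def blNum (r : ℤ) (p : ℕ × ℕ) : ℤ × ℤ →₀ ℂ :=
  -∑ k ∈ Finset.range (p.1 + 1),
      Finsupp.single (r + 2 * (p.1 - 2 * k : ℤ), -(p.1 - 2 * k : ℤ) + (p.2 + 1)) 1 +
  ∑ k ∈ Finset.range (p.1 + 1),
      Finsupp.single (r + 2 * (p.1 - 2 * k : ℤ), -(p.1 - 2 * k : ℤ) - (p.2 + 1)) 1 +
  ∑ k ∈ Finset.range (p.1 + 1),
      Finsupp.single ((p.1 - 2 * k : ℤ) + (p.2 + 1), r - 2 * (p.1 - 2 * k : ℤ)) 1 -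
  ∑ k ∈ Finset.range (p.1 + 1),
      Finsupp.single ((p.1 - 2 * k : ℤ) - (p.2 + 1), r - 2 * (p.1 - 2 * k : ℤ)) 1 -
  ∑ k ∈ Finset.range (p.2 + 1),
      Finsupp.single ((p.2 - 2 * k : ℤ) + (p.1 + 1), (p.2 - 2 * k : ℤ) - (p.1 + 1)) 1 +
  ∑ k ∈ Finset.range (p.2 + 1),
      Finsupp.single ((p.2 - 2 * k : ℤ) - (p.1 + 1), (p.2 - 2 * k : ℤ) + (p.1 + 1)) 1

lemma sum_single_weights_apply (n : ℕ) (g : ℤ → ℤ × ℤ) (v : ℤ × ℤ) (κ : ℤ) (Q : Prop) [Decidable Q]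
    (hg : ∀ l, g l = v ↔ l = κ ∧ Q) :
    (∑ k ∈ Finset.range (n + 1), Finsupp.single (g (n - 2 * k)) (1 : ℂ)) v =
      if -(n : ℤ) ≤ κ ∧ κ ≤ n ∧ (κ - n) % 2 = 0 ∧ Q then 1 else 0 := by
  simp only [Finsupp.coe_finsetSum, Finset.sum_apply, Finsupp.single_apply, hg]
  split_ifs with h
  · obtain ⟨h1, h2, h3, hQ⟩ := h
    rw [Finset.sum_eq_single (((n - κ) / 2).toNat)]
    · rw [if_pos ⟨by omega, hQ⟩]
    · intro k _ hk
      exact if_neg fun hk' => hk (by omega)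
    · intro hk
      exact absurd (Finset.mem_range.mpr (by omega)) hk
  · refine Finset.sum_eq_zero fun k hk => if_neg fun hk' => h ?_
    have := Finset.mem_range.mp hk
    exact ⟨by omega, by omega, by omega, hk'.2⟩

lemma blNum_apply (r : ℤ) (p : ℕ × ℕ) (s t : ℤ) : blNum r p (s, t) = blCoeff r p s t := by
  obtain ⟨n, m⟩ := p
  simp only [blNum, Finsupp.coe_add, Finsupp.coe_sub, Finsupp.coe_neg, Pi.add_apply, Pi.sub_apply,
    Pi.neg_apply]
  rw [sum_single_weights_apply n (fun l => (r + 2 * l, -l + (m + 1))) (s, t) (m + 1 - t)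
      (s = r + 2 * (m + 1 - t)) (by intro l; rw [Prod.mk.injEq]; omega),
    sum_single_weights_apply n (fun l => (r + 2 * l, -l - (m + 1))) (s, t) (-(m + 1) - t)
      (s = r + 2 * (-(m + 1) - t)) (by intro l; rw [Prod.mk.injEq]; omega),
    sum_single_weights_apply n (fun l => (l + (m + 1), r - 2 * l)) (s, t) (s - (m + 1))
      (t = r - 2 * (s - (m + 1))) (by intro l; rw [Prod.mk.injEq]; omega),
    sum_single_weights_apply n (fun l => (l - (m + 1), r - 2 * l)) (s, t) (s + (m + 1))
      (t = r - 2 * (s + (m + 1))) (by intro l; rw [Prod.mk.injEq]; omega),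
    sum_single_weights_apply m (fun l => (l + (n + 1), l - (n + 1))) (s, t) (s - (n + 1))
      (t = s - 2 * (n + 1)) (by intro l; rw [Prod.mk.injEq]; omega),
    sum_single_weights_apply m (fun l => (l - (n + 1), l + (n + 1))) (s, t) (s + (n + 1))
      (t = s + 2 * (n + 1)) (by intro l; rw [Prod.mk.injEq]; omega)]
  simp only [blCoeff]
  push_cast
  rfl

lemma chiSU2_exp (n : ℕ) (z : ℂ) :
    chiSU2 n (Complex.exp z) =
      ∑ k ∈ Finset.range (n + 1), Complex.exp (((n - 2 * k : ℤ) : ℂ) * z) := by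
  simp only [chiSU2, Complex.exp_int_mul]

lemma sub_mul_chiSU2_exp (n : ℕ) (z : ℂ) :
    (Complex.exp z - Complex.exp (-z)) * chiSU2 n (Complex.exp z) =
      Complex.exp ((n + 1) * z) - Complex.exp (-((n + 1) * z)) := by
  rw [chiSU2_exp, Finset.mul_sum]
  have := Finset.sum_range_sub' (fun k : ℕ => Complex.exp ((n + 1 - 2 * k) * z)) (n + 1)
  convert this using 1
  · refine Finset.sum_congr rfl fun k _ => ?_
    rw [sub_mul, ← Complex.exp_add, ← Complex.exp_add]
    push_cast
    ring_nf
  · push_cast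
    ring_nf

lemma linearCombination_blNum (r : ℤ) (p : ℕ × ℕ) (ε : ℂ × ℂ)
    (h1 : Complex.exp (Real.pi * Complex.I * ε.1) -
        Complex.exp (-(Real.pi * Complex.I * ε.1)) ≠ 0)
    (h2 : Complex.exp (Real.pi * Complex.I * ε.2) -
        Complex.exp (-(Real.pi * Complex.I * ε.2)) ≠ 0)
    (h3 : Complex.exp (Real.pi * Complex.I * (ε.1 - ε.2)) -
        Complex.exp (-(Real.pi * Complex.I * (ε.1 - ε.2))) ≠ 0) :
    Finsupp.linearCombination ℂ expMonomial (blNum r p) ε =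
      (Complex.exp (Real.pi * Complex.I * ε.1) - Complex.exp (-(Real.pi * Complex.I * ε.1))) *
      (Complex.exp (Real.pi * Complex.I * ε.2) - Complex.exp (-(Real.pi * Complex.I * ε.2))) *
      (Complex.exp (Real.pi * Complex.I * (ε.1 - ε.2)) -
        Complex.exp (-(Real.pi * Complex.I * (ε.1 - ε.2)))) * Bl p.1 p.2 r ε.1 ε.2 := by
  obtain ⟨n, m⟩ := p
  obtain ⟨u, v⟩ := ε
  simp only at h1 h2 h3 ⊢
  set c : ℂ := Real.pi * Complex.I with hc
  have e1 : Complex.exp (c * (v - u)) - Complex.exp (-(c * (v - u))) =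
      -(Complex.exp (c * (u - v)) - Complex.exp (-(c * (u - v)))) := by
    rw [show c * (v - u) = -(c * (u - v)) by ring, neg_neg]; ring
  have key : (Complex.exp (c * u) - Complex.exp (-(c * u))) *
      (Complex.exp (c * v) - Complex.exp (-(c * v))) *
      (Complex.exp (c * (u - v)) - Complex.exp (-(c * (u - v)))) * Bl n m r u v =
      -(chiSU2 n (Complex.exp (c * (2 * u - v))) * Complex.exp (c * r * u) *
        ((Complex.exp (c * v) - Complex.exp (-(c * v))) * chiSU2 m (Complex.exp (c * v)))) +
      chiSU2 n (Complex.exp (c * (u - 2 * v))) * Complex.exp (c * r * v) *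
        ((Complex.exp (c * u) - Complex.exp (-(c * u))) * chiSU2 m (Complex.exp (c * u))) -
      chiSU2 m (Complex.exp (c * (u + v))) *
        ((Complex.exp (c * (u - v)) - Complex.exp (-(c * (u - v)))) *
          chiSU2 n (Complex.exp (c * (u - v)))) := by
    simp only [Bl, fLR, ← hc]
    rw [e1, show u - (v - u) = 2 * u - v by ring, show u + (v - u) = v by ring,
      show u - v - v = u - 2 * v by ring, show u - v + v = u by ring]
    generalize Complex.exp (c * u) - Complex.exp (-(c * u)) = A at *
    generalize Complex.exp (c * v) - Complex.exp (-(c * v)) = B at *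
    generalize Complex.exp (c * (u - v)) - Complex.exp (-(c * (u - v))) = D at *
    field_simp
  rw [key, sub_mul_chiSU2_exp, sub_mul_chiSU2_exp, sub_mul_chiSU2_exp]
  simp only [chiSU2_exp, blNum, map_add, map_sub, map_neg, map_sum,
    Finsupp.linearCombination_single, one_smul, Pi.add_apply, Pi.sub_apply, Pi.neg_apply,
    Finset.sum_apply, expMonomial, ← hc, mul_sub, Finset.sum_mul, ← Complex.exp_add]
  have reorder : ∀ s₁ s₂ s₃ s₄ s₅ s₆ : ℂ, -(s₁ - s₂) + (s₃ - s₄) - (s₅ - s₆) =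
      -s₁ + s₂ + s₃ - s₄ - s₅ + s₆ := by intros; ring
  rw [reorder]
  refine congrArg₂ (· + ·) (congrArg₂ (· - ·) (congrArg₂ (· - ·) (congrArg₂ (· + ·)
    (congrArg₂ (· + ·) (congrArg Neg.neg ?_) ?_) ?_) ?_) ?_) ?_ <;>
  exact Finset.sum_congr rfl fun k _ => congrArg _ (by push_cast; ring)

lemma sum_mul_blCoeff_eq_zero {r : ℤ} {J : Finset (ℕ × ℕ)} {x : ℕ × ℕ → ℂ} {U : Set (ℂ × ℂ)}
    (hU : IsOpen U) (hne : U.Nonempty)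
    (hdef : ∀ ε ∈ U,
      Complex.exp (Real.pi * Complex.I * ε.1) -
        Complex.exp (-(Real.pi * Complex.I * ε.1)) ≠ 0 ∧
      Complex.exp (Real.pi * Complex.I * ε.2) -
        Complex.exp (-(Real.pi * Complex.I * ε.2)) ≠ 0 ∧
      Complex.exp (Real.pi * Complex.I * (ε.1 - ε.2)) -
        Complex.exp (-(Real.pi * Complex.I * (ε.1 - ε.2))) ≠ 0)
    (hvanish : ∀ ε ∈ U, ∑ p ∈ J, x p * Bl p.1 p.2 r ε.1 ε.2 = 0) (s t : ℤ) :
    ∑ p ∈ J, x p * (blCoeff r p s t : ℂ) = 0 := by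
  have hzero : ∑ p ∈ J, x p • blNum r p = 0 := by
    refine eq_zero_of_linearCombination_expMonomial hU hne fun ε hε => ?_
    obtain ⟨h1, h2, h3⟩ := hdef ε hε
    simp only [map_sum, map_smul, Finset.sum_apply, Pi.smul_apply, smul_eq_mul,
      linearCombination_blNum r _ ε h1 h2 h3]
    simp only [mul_left_comm (x _), ← Finset.mul_sum, hvanish ε hε, mul_zero]
  simpa [blNum_apply] using DFunLike.congr_fun hzero (s, t)

/-- The functions Bl_{(j_L,j_R,R)} with fixed R = r/2 and spins satisfying the
checkerboard parity 2j_L + 2j_R + 1 ≡ 2R (mod 2) are linearly independent,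
except for the identically vanishing Bl_{(0,0,±1/2)} and Bl_{(0,1/2,0)}.
Spins are encoded by (nL, nR) = (2j_L, 2j_R). -/
theorem statement1 (r : ℤ) (J : Finset (ℕ × ℕ))
    (hJ : ∀ p ∈ J, ((p.1 : ℤ) + (p.2 : ℤ) + 1) % 2 = r % 2)
    (x : ℕ × ℕ → ℂ) (U : Set (ℂ × ℂ)) (hU : IsOpen U) (hne : U.Nonempty)
    (hdef : ∀ ε ∈ U,
      Complex.exp (Real.pi * Complex.I * ε.1) -
        Complex.exp (-(Real.pi * Complex.I * ε.1)) ≠ 0 ∧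
      Complex.exp (Real.pi * Complex.I * ε.2) -
        Complex.exp (-(Real.pi * Complex.I * ε.2)) ≠ 0 ∧
      Complex.exp (Real.pi * Complex.I * (ε.1 - ε.2)) -
        Complex.exp (-(Real.pi * Complex.I * (ε.1 - ε.2))) ≠ 0)
    (hvanish : ∀ ε ∈ U, ∑ p ∈ J, x p * Bl p.1 p.2 r ε.1 ε.2 = 0) :
    ∀ p ∈ J, ¬((p = (0, 0) ∧ (r = 1 ∨ r = -1)) ∨ (p = (0, 1) ∧ r = 0)) → x p = 0 := by
  have hcoeff := sum_mul_blCoeff_eq_zero hU hne hdef hvanish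
  intro p hp hexc
  by_contra hxp
  let y : ℕ × ℕ → ℂ := fun q => if q ∈ J then x q else 0
  have hyJ : ∀ q, y q ≠ 0 → q ∈ J := fun q hq => by_contra fun hqJ => hq (if_neg hqJ)
  have hyp : y p ≠ 0 := by simpa only [y, if_pos hp] using hxp
  have hy : ∀ s t : ℤ, ∑ q ∈ J, y q * (blCoeff r q s t : ℂ) = 0 := fun s t => by
    rw [← hcoeff s t]
    exact Finset.sum_congr rfl fun q hq => by rw [show y q = x q from if_pos hq]
  rcases le_total 0 r with hr | hr
  · rcases support_exceptional_of_nonneg hr hJ hyJ hy hyp with h | h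
    · exact hexc (Or.inl ⟨h.1, Or.inl h.2⟩)
    · exact hexc (Or.inr h)
  · have hy' : ∀ s t : ℤ, ∑ q ∈ J, y q * (blCoeff (-r) q s t : ℂ) = 0 := fun s t => by
      have hst := fun q => blCoeff_neg r q (-s) (-t)
      simp only [neg_neg] at hst
      simp [hst, hy]
    rcases support_exceptional_of_nonneg (neg_nonneg.mpr hr)
      (fun q hq => by have := hJ q hq; omega) hyJ hy' hyp with h | h
    · exact hexc (Or.inl ⟨h.1, Or.inr (by omega)⟩)
    · exact hexc (Or.inr ⟨h.1, by omega⟩)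
end

section
/- The three functions Bl_{(0,0,1/2)}, Bl_{(0,0,−1/2)} and Bl_{(0,1/2,0)} vanish identically; that is, for all (ε₁,ε₂) ∈ ℂ² at which the expressions are defined, f_{(0,0)}(ε₁, ε₂−ε₁)e^{±πiε₁} + f_{(0,0)}(ε₁−ε₂, ε₂)e^{±πiε₂} − f_{(0,0)}(ε₁,ε₂) = 0 and f_{(0,1/2)}(ε₁, ε₂−ε₁) + f_{(0,1/2)}(ε₁−ε₂, ε₂) − f_{(0,1/2)}(ε₁,ε₂) = 0. -/
lemma chiSU2_zero (q : ℂ) : chiSU2 0 q = 1 := by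
  simp [chiSU2]

lemma chiSU2_one (q : ℂ) : chiSU2 1 q = q + q⁻¹ := by
  simp [chiSU2, Finset.sum_range_succ]

/-- Clearing the common denominator `a * b * c` of the three blowup terms. -/
lemma blowup_terms_eq_zero {a b c : ℂ} (ha : a ≠ 0) (hb : b ≠ 0) (hc : c ≠ 0)
    {u v w : ℂ} (h : v * a - u * b = w * c) :
    u / (a * -c) + v / (c * b) - w / (a * b) = 0 := by
  field_simp
  linear_combination h

/-- Bl_{(0,0,1/2)}, Bl_{(0,0,−1/2)} and Bl_{(0,1/2,0)} vanish identically
wherever they are defined. Spins encoded by (nL,nR) = (2j_L,2j_R), R = r/2. -/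
theorem statement2 (ε₁ ε₂ : ℂ)
    (h1 : Complex.exp (Real.pi * Complex.I * ε₁) -
      Complex.exp (-(Real.pi * Complex.I * ε₁)) ≠ 0)
    (h2 : Complex.exp (Real.pi * Complex.I * ε₂) -
      Complex.exp (-(Real.pi * Complex.I * ε₂)) ≠ 0)
    (h3 : Complex.exp (Real.pi * Complex.I * (ε₁ - ε₂)) -
      Complex.exp (-(Real.pi * Complex.I * (ε₁ - ε₂))) ≠ 0) :
    Bl 0 0 1 ε₁ ε₂ = 0 ∧ Bl 0 0 (-1) ε₁ ε₂ = 0 ∧ Bl 0 1 0 ε₁ ε₂ = 0 := by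
  have hx := Complex.exp_ne_zero (Real.pi * Complex.I * ε₁)
  have hy := Complex.exp_ne_zero (Real.pi * Complex.I * ε₂)
  have hneg : Complex.exp (Real.pi * Complex.I * (ε₂ - ε₁)) -
      Complex.exp (-(Real.pi * Complex.I * (ε₂ - ε₁))) =
      -(Complex.exp (Real.pi * Complex.I * (ε₁ - ε₂)) -
        Complex.exp (-(Real.pi * Complex.I * (ε₁ - ε₂)))) := by
    rw [neg_sub]
    congr 2 <;> ring
  refine ⟨?_, ?_, ?_⟩ <;>
    simp only [Bl, fLR, chiSU2_zero, chiSU2_one, hneg, one_mul, div_mul_eq_mul_div,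
      add_sub_cancel, sub_add_cancel] <;>
    refine blowup_terms_eq_zero h1 h2 h3 ?_ <;>
    simp only [Int.cast_one, Int.cast_neg, Int.cast_zero, mul_one, mul_zero, zero_mul, mul_neg,
      neg_mul, mul_add, mul_sub, neg_sub, Complex.exp_add, Complex.exp_sub, Complex.exp_neg,
      Complex.exp_zero] <;>
    field_simp <;>
    ring
end

section
/- For every τ in the upper half-plane ℍ and all λ, ε₁, ε₂ ∈ ℂ, the following theta-function identity holds: θ₁(τ, ε₂)·θ₁(τ, λ + ε₂)·θ₃(2τ, λ + 2ε₁) − θ₁(τ, ε₁)·θ₁(τ, λ + ε₁)·θ₃(2τ, λ + 2ε₂) = θ₁(τ, ε₂ − ε₁)·θ₁(τ, λ + ε₁ + ε₂)·θ₃(2τ, λ). -/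
/-- The Jacobi theta function θ₃(τ,z). -/
noncomputable def theta3 (τ z : ℂ) : ℂ :=
  ∑' n : ℤ, Complex.exp (Real.pi * Complex.I * τ * (n : ℂ) ^ 2 +
    2 * Real.pi * Complex.I * (n : ℂ) * z)

open Complex

/-- The theta function θ₂(τ,z). -/
noncomputable def theta2 (τ z : ℂ) : ℂ :=
  ∑' n : ℤ, exp (Real.pi * I * τ * ((n : ℂ) + 1 / 2) ^ 2 +
    2 * Real.pi * I * ((n : ℂ) + 1 / 2) * z)

lemma neg_one_zpow_eq_exp (n : ℤ) : (-1 : ℂ) ^ n = exp (n * (Real.pi * I)) := by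
  rw [exp_int_mul, exp_pi_mul_I]

lemma summable_theta3_term {τ : ℂ} (hτ : 0 < τ.im) (z : ℂ) :
    Summable fun n : ℤ => exp (Real.pi * I * τ * (n : ℂ) ^ 2 + 2 * Real.pi * I * (n : ℂ) * z) := by
  refine ((summable_jacobiTheta₂_term_iff z τ).2 hτ).congr fun n => ?_
  rw [jacobiTheta₂_term]
  ring_nf

lemma summable_theta2_term {τ : ℂ} (hτ : 0 < τ.im) (z : ℂ) :
    Summable fun n : ℤ => exp (Real.pi * I * τ * ((n : ℂ) + 1 / 2) ^ 2 +
      2 * Real.pi * I * ((n : ℂ) + 1 / 2) * z) := by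
  refine ((summable_theta3_term hτ (z + τ / 2)).mul_left
    (exp (Real.pi * I * τ / 4 + Real.pi * I * z))).congr fun n => ?_
  rw [← exp_add]
  ring_nf

lemma summable_theta1_term {τ : ℂ} (hτ : 0 < τ.im) (z : ℂ) :
    Summable fun n : ℤ => (-1 : ℂ) ^ n * exp (Real.pi * I * τ * ((n : ℂ) + 1 / 2) ^ 2 +
      2 * Real.pi * I * ((n : ℂ) + 1 / 2) * z) := by
  refine ((summable_theta2_term hτ (z + 1 / 2)).mul_left
    (exp (-(Real.pi * I / 2)))).congr fun n => ?_
  rw [neg_one_zpow_eq_exp, ← exp_add, ← exp_add]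
  ring_nf

/-- The change of summation indices `(n, m) ↦ (n + m + 1, m - n)`, split by the parity of
`n + m + 1`. -/
def sumDiffEquiv : (ℤ × ℤ) ⊕ (ℤ × ℤ) ≃ ℤ × ℤ where
  toFun := Sum.elim (fun p => (p.1 - p.2 - 1, p.1 + p.2)) (fun p => (p.1 - p.2, p.1 + p.2))
  invFun q := if (q.1 + q.2) % 2 = 0 then .inr ((q.1 + q.2) / 2, (q.2 - q.1) / 2)
    else .inl ((q.1 + q.2 + 1) / 2, (q.2 - q.1 - 1) / 2)
  left_inv := by
    rintro (⟨k, l⟩ | ⟨k, l⟩)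
    · have h : ¬ (k - l - 1 + (k + l)) % 2 = 0 := by lia
      simp only [Sum.elim_inl, h, if_false, Sum.inl.injEq, Prod.mk.injEq]
      lia
    · have h : (k - l + (k + l)) % 2 = 0 := by lia
      simp only [Sum.elim_inr, h, if_true, Sum.inr.injEq, Prod.mk.injEq]
      lia
  right_inv := by
    rintro ⟨n, m⟩
    by_cases h : (n + m) % 2 = 0
    · simp only [h, if_true, Sum.elim_inr, Prod.mk.injEq]
      lia
    · simp only [h, if_false, Sum.elim_inl, Prod.mk.injEq]
      lia

lemma hasSum_prod_mul {f g : ℤ → ℂ} (hf : Summable f) (hg : Summable g) :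
    HasSum (fun p : ℤ × ℤ => f p.1 * g p.2) ((∑' n, f n) * ∑' n, g n) :=
  hf.hasSum.mul hg.hasSum (summable_mul_of_summable_norm hf.norm hg.norm)

/-- A product of two θ₁ in terms of θ₂ and θ₃ of twice the modulus. -/
lemma theta1_mul_theta1 {τ : ℂ} (hτ : 0 < τ.im) (x y : ℂ) :
    theta1 τ x * theta1 τ y =
      theta3 (2 * τ) (x + y) * theta2 (2 * τ) (y - x) -
        theta2 (2 * τ) (x + y) * theta3 (2 * τ) (y - x) := by
  have h2τ : 0 < (2 * τ).im := by simpa using hτ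
  have hprod := hasSum_prod_mul (summable_theta1_term hτ x) (summable_theta1_term hτ y)
  have heven := hasSum_prod_mul (summable_theta3_term h2τ (x + y))
    (summable_theta2_term h2τ (y - x))
  have hodd := hasSum_prod_mul (summable_theta2_term h2τ (x + y))
    (summable_theta3_term h2τ (y - x))
  rw [← sumDiffEquiv.hasSum_iff] at hprod
  have hsum := hprod.unique (HasSum.sum
    (heven.neg.congr_fun fun ⟨k, l⟩ => ?_) (hodd.congr_fun fun ⟨k, l⟩ => ?_))
  · simp only [theta1, theta2, theta3]
    rw [mul_mul_mul_comm, hsum, neg_mul_neg, I_mul_I]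
    ring
  · have hsign : (-1 : ℂ) ^ (k - l - 1) * (-1) ^ (k + l) = -1 := by
      rw [← zpow_add₀ (by simp)]
      exact Odd.neg_one_zpow ⟨k - 1, by ring⟩
    simp only [sumDiffEquiv, Function.comp_apply, Equiv.coe_fn_mk, Sum.elim_inl]
    rw [mul_mul_mul_comm, hsign, ← exp_add, ← exp_add, neg_one_mul]
    push_cast
    ring_nf
  · have hsign : (-1 : ℂ) ^ (k - l) * (-1) ^ (k + l) = 1 := by
      rw [← zpow_add₀ (by simp)]
      exact Even.neg_one_zpow ⟨k, by ring⟩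
    simp only [sumDiffEquiv, Function.comp_apply, Equiv.coe_fn_mk, Sum.elim_inr]
    rw [mul_mul_mul_comm, hsign, ← exp_add, ← exp_add, one_mul]
    push_cast
    ring_nf

/-- The theta identity
θ₁(ε₂)θ₁(λ+ε₂)θ₃(2τ,λ+2ε₁) − θ₁(ε₁)θ₁(λ+ε₁)θ₃(2τ,λ+2ε₂)
= θ₁(ε₂−ε₁)θ₁(λ+ε₁+ε₂)θ₃(2τ,λ). -/
theorem statement7 (τ : ℂ) (hτ : 0 < τ.im) (lam ε₁ ε₂ : ℂ) :
    theta1 τ ε₂ * theta1 τ (lam + ε₂) * theta3 (2 * τ) (lam + 2 * ε₁) -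
      theta1 τ ε₁ * theta1 τ (lam + ε₁) * theta3 (2 * τ) (lam + 2 * ε₂) =
    theta1 τ (ε₂ - ε₁) * theta1 τ (lam + ε₁ + ε₂) * theta3 (2 * τ) lam := by
  simp only [theta1_mul_theta1 hτ]
  rw [show ε₂ + (lam + ε₂) = lam + 2 * ε₂ by ring, show lam + ε₂ - ε₂ = lam by ring,
    show ε₁ + (lam + ε₁) = lam + 2 * ε₁ by ring, show lam + ε₁ - ε₁ = lam by ring,
    show ε₂ - ε₁ + (lam + ε₁ + ε₂) = lam + 2 * ε₂ by ring,
    show lam + ε₁ + ε₂ - (ε₂ - ε₁) = lam + 2 * ε₁ by ring]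
  ring
end

section
/- For every R ∈ ℤ + 1/2 with R ≥ 1/2, the function Bl_{(0,0,R)} has the closed form Bl_{(0,0,R)}(ε₁, ε₂) = − ∑_{m,n ≥ 0, m+n ≤ R − 3/2} e^{2πi((m + 1/2)ε₁ + (n + 1/2)ε₂)}, as an identity of meromorphic functions on ℂ² (the sum on the right runs over pairs of nonnegative integers (m,n) with m + n ≤ R − 3/2, and is empty when R = 1/2). -/
/-- The function f_{(0,0)}(ε₁,ε₂) = 1/((e^{πiε₁}−e^{−πiε₁})(e^{πiε₂}−e^{−πiε₂})). -/
noncomputable def f00 (ε₁ ε₂ : ℂ) : ℂ :=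
  1 / ((Complex.exp (Real.pi * Complex.I * ε₁) - Complex.exp (-(Real.pi * Complex.I * ε₁))) *
   (Complex.exp (Real.pi * Complex.I * ε₂) - Complex.exp (-(Real.pi * Complex.I * ε₂))))

/-- The function Bl_{(0,0,R)}(ε₁,ε₂) with R = r/2. -/
noncomputable def Bl00 (r : ℤ) (ε₁ ε₂ : ℂ) : ℂ :=
  f00 ε₁ (ε₂ - ε₁) * Complex.exp (Real.pi * Complex.I * (r : ℂ) * ε₁) +
  f00 (ε₁ - ε₂) ε₂ * Complex.exp (Real.pi * Complex.I * (r : ℂ) * ε₂) -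
  f00 ε₁ ε₂

/-- Closed form of `∑_{m+n<k} aᵐ bⁿ`, with denominators cleared. -/
lemma triangular_geom_sum_mul {A : Type*} [CommRing A] (a b : A) (k : ℕ) :
    (∑ m ∈ Finset.range k, ∑ n ∈ Finset.range (k - m), a ^ m * b ^ n) *
        ((a - 1) * (b - a) * (b - 1)) =
      b ^ (k + 1) * (a - 1) - a ^ (k + 1) * (b - 1) + (b - a) := by
  induction k with
  | zero => simp; ring
  | succ k ih =>
    have hsucc : ∑ m ∈ Finset.range (k + 1), ∑ n ∈ Finset.range (k + 1 - m), a ^ m * b ^ n =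
        a * (∑ m ∈ Finset.range k, ∑ n ∈ Finset.range (k - m), a ^ m * b ^ n) +
          ∑ n ∈ Finset.range (k + 1), b ^ n := by
      rw [Finset.sum_range_succ']
      simp [Finset.mul_sum, pow_succ', mul_assoc]
    rw [hsucc]
    linear_combination a * ih + (a - 1) * (b - a) * geom_sum_mul b (k + 1)

/-- For R = r/2 ∈ ℤ + 1/2 with R ≥ 1/2, the closed form
Bl_{(0,0,R)}(ε₁,ε₂) = −∑_{m,n≥0, m+n≤R−3/2} e^{2πi((m+1/2)ε₁+(n+1/2)ε₂)},
valid wherever the left-hand side is defined.  The sum over pairs (m,n) of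
nonnegative integers with m+n ≤ R−3/2 = (r−3)/2 is written as a double sum
with m < (r−1)/2 and n < (r−1)/2 − m. -/
theorem statement10 (r : ℤ) (hodd : Odd r) (hpos : 1 ≤ r) (ε₁ ε₂ : ℂ)
    (h1 : Complex.exp (Real.pi * Complex.I * ε₁) -
      Complex.exp (-(Real.pi * Complex.I * ε₁)) ≠ 0)
    (h2 : Complex.exp (Real.pi * Complex.I * ε₂) -
      Complex.exp (-(Real.pi * Complex.I * ε₂)) ≠ 0)
    (h3 : Complex.exp (Real.pi * Complex.I * (ε₁ - ε₂)) -
      Complex.exp (-(Real.pi * Complex.I * (ε₁ - ε₂))) ≠ 0) :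
    Bl00 r ε₁ ε₂ =
      -∑ m ∈ Finset.range ((r - 1) / 2).toNat,
        ∑ n ∈ Finset.range (((r - 1) / 2).toNat - m),
          Complex.exp (2 * Real.pi * Complex.I *
            (((m : ℂ) + 1 / 2) * ε₁ + ((n : ℂ) + 1 / 2) * ε₂)) := by
  obtain ⟨j, rfl⟩ := hodd
  obtain ⟨k, rfl⟩ := Int.eq_ofNat_of_zero_le (show 0 ≤ j by omega)
  have hk : ((2 * (k : ℤ) + 1 - 1) / 2).toNat = k := by omega
  rw [hk]
  unfold Bl00 f00
  set x := Complex.exp (Real.pi * Complex.I * ε₁) with hx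
  set y := Complex.exp (Real.pi * Complex.I * ε₂) with hy
  have hx0 : x ≠ 0 := Complex.exp_ne_zero _
  have hy0 : y ≠ 0 := Complex.exp_ne_zero _
  have hterm (m n : ℕ) : Complex.exp (2 * Real.pi * Complex.I *
      (((m : ℂ) + 1 / 2) * ε₁ + ((n : ℂ) + 1 / 2) * ε₂)) =
        x * y * ((x ^ 2) ^ m * (y ^ 2) ^ n) := by
    simp only [hx, hy, ← Complex.exp_nat_mul, ← Complex.exp_add]
    congr 1
    push_cast
    ring
  have hpow (ε : ℂ) : Complex.exp (Real.pi * Complex.I * ((2 * (k : ℤ) + 1 : ℤ) : ℂ) * ε) =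
      Complex.exp (Real.pi * Complex.I * ε) ^ (2 * k + 1) := by
    rw [← Complex.exp_nat_mul]
    congr 1
    push_cast
    ring
  have hexp_sub (ε δ : ℂ) : Complex.exp (Real.pi * Complex.I * (ε - δ)) =
      Complex.exp (Real.pi * Complex.I * ε) / Complex.exp (Real.pi * Complex.I * δ) := by
    rw [mul_sub, Complex.exp_sub]
  simp only [hterm, ← Finset.mul_sum, hpow, hexp_sub, Complex.exp_neg, ← hx, ← hy,
    inv_div] at h1 h2 h3 ⊢
  have hx1 : x - x⁻¹ = (x ^ 2 - 1) / x := by field_simp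
  have hy1 : y - y⁻¹ = (y ^ 2 - 1) / y := by field_simp
  have hxy : x / y - y / x = -(y ^ 2 - x ^ 2) / (x * y) := by field_simp; ring
  have hyx : y / x - x / y = (y ^ 2 - x ^ 2) / (x * y) := by field_simp
  have ha : x ^ 2 - 1 ≠ 0 := fun h => h1 (by rw [hx1, h, zero_div])
  have hb : y ^ 2 - 1 ≠ 0 := fun h => h2 (by rw [hy1, h, zero_div])
  have hba : y ^ 2 - x ^ 2 ≠ 0 := fun h => h3 (by rw [hxy, h, neg_zero, zero_div])
  have hsum := eq_div_of_mul_eq (mul_ne_zero (mul_ne_zero ha hba) hb)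
    (triangular_geom_sum_mul (x ^ 2) (y ^ 2) k)
  simp only [← Finset.mul_sum] at hsum
  rw [hx1, hy1, hxy, hyx, hsum]
  field_simp
  ring
end

section
/- Theta functions with pairwise inequivalent characteristics are linearly independent: fix τ in the upper half-plane ℍ, and let a₁, …, a_k ∈ ℝ be such that a_i − a_j ∉ ℤ for all i ≠ j. If c₁, …, c_k ∈ ℂ satisfy ∑_{j=1}^k c_j · θ^{[a_j]}(τ, z) = 0 for all z ∈ ℂ, then c₁ = ⋯ = c_k = 0. -/
/-- The theta function with characteristic a:
θ^{[a]}(τ,z) = ∑_{n∈ℤ} exp(πiτ(n+a)² + 2πi(n+a)z). -/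
noncomputable def thetaChar (a : ℝ) (τ z : ℂ) : ℂ :=
  ∑' n : ℤ, Complex.exp (Real.pi * Complex.I * τ * ((n : ℂ) + (a : ℂ)) ^ 2 +
    2 * Real.pi * Complex.I * ((n : ℂ) + (a : ℂ)) * z)

lemma thetaChar_eq_exp_mul_jacobiTheta₂ (a : ℝ) (τ z : ℂ) :
    thetaChar a τ z = Complex.exp (Real.pi * Complex.I * τ * (a : ℂ) ^ 2 +
      2 * Real.pi * Complex.I * (a : ℂ) * z) * jacobiTheta₂ (z + a * τ) τ := by
  rw [thetaChar, jacobiTheta₂, ← tsum_mul_left]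
  refine tsum_congr fun n => ?_
  rw [jacobiTheta₂_term, ← Complex.exp_add]
  ring_nf

lemma thetaChar_add_one (a : ℝ) (τ z : ℂ) :
    thetaChar a τ (z + 1) = Complex.exp (2 * Real.pi * Complex.I * a) * thetaChar a τ z := by
  rw [thetaChar_eq_exp_mul_jacobiTheta₂, thetaChar_eq_exp_mul_jacobiTheta₂, add_right_comm,
    jacobiTheta₂_add_left, ← mul_assoc, ← Complex.exp_add]
  ring_nf

lemma integral_jacobiTheta₂_term (n : ℤ) (τ : ℂ) :
    ∫ x in (0 : ℝ)..1, jacobiTheta₂_term n x τ = if n = 0 then 1 else 0 := by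
  split_ifs with hn
  · simp [hn, jacobiTheta₂_term]
  · have hc : 2 * (Real.pi : ℂ) * Complex.I * n ≠ 0 := by
      simp [hn, Real.pi_ne_zero]
    have hexp : Complex.exp (2 * Real.pi * Complex.I * n) = 1 :=
      Complex.exp_eq_one_iff.mpr ⟨n, by ring⟩
    simp [jacobiTheta₂_term, Complex.exp_add, integral_exp_mul_complex hc, hexp]

/-- The constant Fourier coefficient of the Jacobi theta function is `1`. -/
lemma integral_jacobiTheta₂ {τ : ℂ} (hτ : 0 < τ.im) :
    ∫ x in (0 : ℝ)..1, jacobiTheta₂ x τ = 1 := by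
  have hsum := intervalIntegral.hasSum_integral_of_dominated_convergence
    (μ := MeasureTheory.volume) (a := 0) (b := 1)
    (F := fun (n : ℤ) (x : ℝ) => jacobiTheta₂_term n x τ)
    (f := fun x : ℝ => jacobiTheta₂ x τ)
    (fun n _ => ‖jacobiTheta₂_term n 0 τ‖)
    (fun n => Continuous.aestronglyMeasurable (by unfold jacobiTheta₂_term; fun_prop))
    (fun n => .of_forall fun x _ => by simp [norm_jacobiTheta₂_term])
    (.of_forall fun _ _ => ((summable_jacobiTheta₂_term_iff 0 τ).mpr hτ).norm)
    (by simp)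
    (.of_forall fun x _ => hasSum_jacobiTheta₂_term x hτ)
  simp only [integral_jacobiTheta₂_term] at hsum
  exact hsum.unique (hasSum_ite_eq 0 1)

lemma thetaChar_ne_zero (a : ℝ) {τ : ℂ} (hτ : 0 < τ.im) : thetaChar a τ ≠ 0 := by
  intro h
  have hzero (z : ℂ) : jacobiTheta₂ z τ = 0 := by
    have hz := congrFun h (z - a * τ)
    simpa [thetaChar_eq_exp_mul_jacobiTheta₂] using hz
  simpa [hzero] using integral_jacobiTheta₂ hτ

lemma exp_two_pi_mul_I_mul_ne {x y : ℝ} (h : ∀ n : ℤ, x - y ≠ n) :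
    Complex.exp (2 * Real.pi * Complex.I * x) ≠ Complex.exp (2 * Real.pi * Complex.I * y) := by
  intro hxy
  obtain ⟨n, hn⟩ := Complex.exp_eq_exp_iff_exists_int.mp hxy
  have hmul : 2 * Real.pi * Complex.I * (x : ℂ) = 2 * Real.pi * Complex.I * (y + n) := by
    rw [hn]; ring
  have hx : (x : ℂ) = y + n := mul_left_cancel₀ Complex.two_pi_I_ne_zero hmul
  have hx' : x = y + n := by exact_mod_cast hx
  exact h n (by rw [hx']; ring)

lemma linearIndependent_thetaChar {ι : Type*} {τ : ℂ} (hτ : 0 < τ.im) (a : ι → ℝ)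
    (ha : ∀ i j : ι, i ≠ j → ∀ n : ℤ, a i - a j ≠ n) :
    LinearIndependent ℂ fun j => thetaChar (a j) τ := by
  refine Module.End.eigenvectors_linearIndependent' (LinearMap.funLeft ℂ ℂ fun z : ℂ => z + 1)
    (fun j => Complex.exp (2 * Real.pi * Complex.I * a j)) (fun i j hij => ?_) _ fun j =>
      Module.End.hasEigenvector_iff.mpr
        ⟨Module.End.mem_eigenspace_iff.mpr (funext fun z => thetaChar_add_one (a j) τ z),
          thetaChar_ne_zero (a j) hτ⟩
  by_contra hne
  exact exp_two_pi_mul_I_mul_ne (ha i j hne) hij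

/-- Theta functions with pairwise inequivalent characteristics (mod 1) are
linearly independent as functions of z. -/
theorem statement11 (τ : ℂ) (hτ : 0 < τ.im) (k : ℕ) (a : Fin k → ℝ)
    (ha : ∀ i j : Fin k, i ≠ j → ∀ n : ℤ, a i - a j ≠ n)
    (c : Fin k → ℂ) (h : ∀ z : ℂ, ∑ j, c j * thetaChar (a j) τ z = 0) :
    ∀ j, c j = 0 := by
  refine Fintype.linearIndependent_iff.mp (linearIndependent_thetaChar hτ a ha) c
    (funext fun z => ?_)
  simpa using h z
end
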